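/- Set K̂ = I − (q − q⁻¹)·MD, with underline copies K̂_{[1]} = K̂₁, K̂_{[r+1]} = R_r⁻¹ K̂_{[r]} R_r, and K̂_{[p→1]} = K̂_{[p]} ⋯ K̂_{[1]}. Let n, p ≥ 1, let Q belong to the unital subalgebra of End(V^{⊗p}) generated by R₁, …, R_{p−1}, and let Z belong to the unital subalgebra of End(V^{⊗n}) generated by R₁, …, R_{n−1}. Then there exists Z̃ in the unital subalgebra of End(V^{⊗n}) generated by R₁, …, R_{n−1} such that Tr_{R(1…p)}(Q · K̂_{[p→1]}) · Tr_{R(1…n)}(Z · M_{⟨1→n⟩}) − Tr_{R(1…n)}(Z̃ · M_{⟨1→n⟩}) belongs to the left ideal of A generated by the entries of D. (Equivalently: every generalized quantum Casimir operator maps the characteristic subalgebra of the reflection-equation algebra into itself, preserving the degree in M.) -/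

import Mathlib

open scoped BigOperators

noncomputable section

/-- One-site embedding of an `N×N` matrix into `Mat_{N^k}` at 0-based position `i`
(the paper's `X_{i+1}` in 1-based numbering).  Out of range we return the identity. -/
def matAt {α : Type*} [Semiring α] (N k : ℕ) (X : Matrix (Fin N) (Fin N) α) (i : ℕ) :
    Matrix (Fin k → Fin N) (Fin k → Fin N) α :=
  if h : i < k then
    Matrix.of fun a b =>
      if ∀ l : Fin k, (l : ℕ) ≠ i → a l = b l then X (a ⟨i, h⟩) (b ⟨i, h⟩) else 0
  else 1

/-- Two-site embedding of an operator on `V⊗V` into `Mat_{N^k}` at 0-based positions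
`i, i+1` (the paper's `R_{i+1}` in 1-based numbering). -/
def opAt {α : Type*} [Semiring α] (N k : ℕ)
    (R : Matrix (Fin N × Fin N) (Fin N × Fin N) α) (i : ℕ) :
    Matrix (Fin k → Fin N) (Fin k → Fin N) α :=
  if h : i + 1 < k then
    Matrix.of fun a b =>
      if ∀ l : Fin k, (l : ℕ) ≠ i → (l : ℕ) ≠ i + 1 → a l = b l then
        R (a ⟨i, by omega⟩, a ⟨i + 1, h⟩) (b ⟨i, by omega⟩, b ⟨i + 1, h⟩)
      else 0
  else 1

/-- A numeric (complex) matrix viewed inside `Mat(A)` via the unit of `A`. -/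
def toA (A : Type*) [Semiring A] [Algebra ℂ A] {ι : Type*} (X : Matrix ι ι ℂ) :
    Matrix ι ι A :=
  X.map (algebraMap ℂ A)

/-- The braid relation `R₁R₂R₁ = R₂R₁R₂` on `V^{⊗3}`. -/
def IsBraid (N : ℕ) (R : Matrix (Fin N × Fin N) (Fin N × Fin N) ℂ) : Prop :=
  opAt N 3 R 0 * opAt N 3 R 1 * opAt N 3 R 0 = opAt N 3 R 1 * opAt N 3 R 0 * opAt N 3 R 1

/-- The Hecke condition `(q·I − R)(q⁻¹·I + R) = 0`. -/
def IsHecke (N : ℕ) (q : ℂ) (R : Matrix (Fin N × Fin N) (Fin N × Fin N) ℂ) : Prop :=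
  (q • (1 : Matrix (Fin N × Fin N) (Fin N × Fin N) ℂ) - R) * (q⁻¹ • 1 + R) = 0

/-- `q` is generic: `q ∉ {0, 1, −1}` and `qⁿ ≠ 1` for all positive integers `n`. -/
def GenericQ (q : ℂ) : Prop :=
  q ≠ 0 ∧ q ≠ 1 ∧ q ≠ -1 ∧ ∀ n : ℕ, 0 < n → q ^ n ≠ 1

/-- The reflection-equation type relation `R X₁ R X₁ = X₁ R X₁ R` in `Mat_{N²}`. -/
def RErel {α : Type*} [Semiring α] (N : ℕ)
    (R : Matrix (Fin N × Fin N) (Fin N × Fin N) α) (X : Matrix (Fin N) (Fin N) α) : Prop :=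
  opAt N 2 R 0 * matAt N 2 X 0 * opAt N 2 R 0 * matAt N 2 X 0 =
    matAt N 2 X 0 * opAt N 2 R 0 * matAt N 2 X 0 * opAt N 2 R 0

/-- The quantum-double permutation relation `D₁ R M₁ R = R M₁ R⁻¹ D₁ + R` in `Mat_{N²}(A)`. -/
def PermRel {A : Type*} [Ring A] [Algebra ℂ A] (N : ℕ)
    (R Rinv : Matrix (Fin N × Fin N) (Fin N × Fin N) ℂ)
    (M D : Matrix (Fin N) (Fin N) A) : Prop :=
  matAt N 2 D 0 * opAt N 2 (toA A R) 0 * matAt N 2 M 0 * opAt N 2 (toA A R) 0 =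
    opAt N 2 (toA A R) 0 * matAt N 2 M 0 * opAt N 2 (toA A Rinv) 0 * matAt N 2 D 0 +
      opAt N 2 (toA A R) 0

/-- The homogeneous permutation relation `D₁ R M₁ R = R M₁ R⁻¹ D₁` in `Mat_{N²}(A)`. -/
def PermRelHom {A : Type*} [Ring A] [Algebra ℂ A] (N : ℕ)
    (R Rinv : Matrix (Fin N × Fin N) (Fin N × Fin N) ℂ)
    (M D : Matrix (Fin N) (Fin N) A) : Prop :=
  matAt N 2 D 0 * opAt N 2 (toA A R) 0 * matAt N 2 M 0 * opAt N 2 (toA A R) 0 =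
    opAt N 2 (toA A R) 0 * matAt N 2 M 0 * opAt N 2 (toA A Rinv) 0 * matAt N 2 D 0

/-- Overline copies: `ovCopy … r = X_{⟨r+1⟩}`, i.e. `X_{⟨1⟩} = X⊗I⊗⋯⊗I` and
`X_{⟨r+1⟩} = R_r X_{⟨r⟩} R_r⁻¹`. -/
def ovCopy {α : Type*} [Semiring α] (N k : ℕ)
    (R Rinv : Matrix (Fin N × Fin N) (Fin N × Fin N) α)
    (X : Matrix (Fin N) (Fin N) α) : ℕ → Matrix (Fin k → Fin N) (Fin k → Fin N) α
  | 0 => matAt N k X 0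
  | r + 1 => opAt N k R r * ovCopy N k R Rinv X r * opAt N k Rinv r

/-- Underline copies: `unCopy … r = X_{[r+1]}`, i.e. `X_{[1]} = X⊗I⊗⋯⊗I` and
`X_{[r+1]} = R_r⁻¹ X_{[r]} R_r`. -/
def unCopy {α : Type*} [Semiring α] (N k : ℕ)
    (R Rinv : Matrix (Fin N × Fin N) (Fin N × Fin N) α)
    (X : Matrix (Fin N) (Fin N) α) : ℕ → Matrix (Fin k → Fin N) (Fin k → Fin N) α
  | 0 => matAt N k X 0
  | r + 1 => opAt N k Rinv r * unCopy N k R Rinv X r * opAt N k R r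

/-- `X_{⟨1→n⟩} = X_{⟨1⟩}X_{⟨2⟩}⋯X_{⟨n⟩}`. -/
def ovProd {α : Type*} [Semiring α] (N k : ℕ)
    (R Rinv : Matrix (Fin N × Fin N) (Fin N × Fin N) α)
    (X : Matrix (Fin N) (Fin N) α) (n : ℕ) : Matrix (Fin k → Fin N) (Fin k → Fin N) α :=
  ((List.range n).map (ovCopy N k R Rinv X)).prod

/-- `X_{⟨n→1⟩} = X_{⟨n⟩}X_{⟨n−1⟩}⋯X_{⟨1⟩}`. -/
def ovProdRev {α : Type*} [Semiring α] (N k : ℕ)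
    (R Rinv : Matrix (Fin N × Fin N) (Fin N × Fin N) α)
    (X : Matrix (Fin N) (Fin N) α) (n : ℕ) : Matrix (Fin k → Fin N) (Fin k → Fin N) α :=
  ((List.range n).reverse.map (ovCopy N k R Rinv X)).prod

/-- Shifted Jucys–Murphy matrices: `JMup … R n s = J_{s+1}^{↑n}`, i.e. `J₁^{↑n} = I` and
`J_{s+1}^{↑n} = R_{n+s} J_s^{↑n} R_{n+s}` (paper's 1-based `R_{n+s}` is `opAt … (n+s-1)`).
Applying it to `R⁻¹` produces `(J_{s+1}^{↑n})⁻¹`. -/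
def JMup {α : Type*} [Semiring α] (N k : ℕ)
    (R : Matrix (Fin N × Fin N) (Fin N × Fin N) α) (n : ℕ) :
    ℕ → Matrix (Fin k → Fin N) (Fin k → Fin N) α
  | 0 => 1
  | s + 1 => opAt N k R (n + s) * JMup N k R n s * opAt N k R (n + s)

/-- The quantum trace `Tr_{R(1…n)}(X) = Tr(C₁C₂⋯C_n X)`. -/
def qTr {α : Type*} [Semiring α] (N n : ℕ) (C : Matrix (Fin N) (Fin N) α)
    (X : Matrix (Fin n → Fin N) (Fin n → Fin N) α) : α :=
  Matrix.trace (((List.range n).map (matAt N n C)).prod * X)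

/-- The matrix `C`, `C_i^j = Σ_k Ψ_{ik}^{jk}`. -/
def traceMat (N : ℕ) (Ψ : Matrix (Fin N × Fin N) (Fin N × Fin N) ℂ) :
    Matrix (Fin N) (Fin N) ℂ :=
  Matrix.of fun i j => ∑ k, Ψ (i, k) (j, k)

/-- Skew-invertibility of `R`: `Tr₂(R₁₂Ψ₂₃) = Tr₂(Ψ₁₂R₂₃) = P₁₃`, written componentwise. -/
def SkewInv (N : ℕ) (R Ψ : Matrix (Fin N × Fin N) (Fin N × Fin N) ℂ) : Prop :=
  (∀ i k l n : Fin N, ∑ j, ∑ b, R (i, j) (l, b) * Ψ (b, k) (j, n) =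
      if i = n ∧ k = l then 1 else 0) ∧
  (∀ i k l n : Fin N, ∑ j, ∑ b, Ψ (i, j) (l, b) * R (b, k) (j, n) =
      if i = n ∧ k = l then 1 else 0)

/-- The generators `R₁, …, R_{n−1}` (1-based) of the Hecke-algebra image inside
`End(V^{⊗k})`, as a subset of `Mat_{N^k}`. -/
def genSet {α : Type*} [Semiring α] (N k n : ℕ)
    (R : Matrix (Fin N × Fin N) (Fin N × Fin N) α) :
    Set (Matrix (Fin k → Fin N) (Fin k → Fin N) α) :=
  {X | ∃ i : ℕ, i + 1 < n ∧ X = opAt N k R i}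

/-- The left ideal of `A` generated by the entries of `D`. -/
def entryIdeal (A : Type*) [Ring A] {N : ℕ} (D : Matrix (Fin N) (Fin N) A) :
    Submodule A A :=
  Submodule.span A {x : A | ∃ i j : Fin N, x = D i j}

/-- The normally ordered monomial `:L̂_{⟨1→k⟩}: = M_{⟨1→k⟩} D_{⟨k→1⟩} ∏_{s=1}^{k} J_s⁻¹`. -/
def normOrd {α : Type*} [Semiring α] (N k : ℕ)
    (R Rinv : Matrix (Fin N × Fin N) (Fin N × Fin N) α)
    (M D : Matrix (Fin N) (Fin N) α) (n : ℕ) :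
    Matrix (Fin k → Fin N) (Fin k → Fin N) α :=
  ovProd N k R Rinv M n * ovProdRev N k R Rinv D n *
    ((List.range n).map (fun s => JMup N k Rinv 0 s)).prod

section LocalEmbedding

variable {α σ ι κ τ : Type*} [Fintype σ] [DecidableEq σ] [Fintype ι] [DecidableEq ι] [Fintype κ]
  [DecidableEq κ] [Fintype τ] [DecidableEq τ]

open Classical in
/-- The operator on `V^{⊗κ}` acting as `X` on the tensor factors selected by `e : ι → κ` and
as the identity on the others. -/
def localize [Zero α] (e : ι → κ) (X : Matrix (ι → σ) (ι → σ) α) : Matrix (κ → σ) (κ → σ) α :=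
  Matrix.of fun a b => if ∀ l, l ∉ Set.range e → a l = b l then X (a ∘ e) (b ∘ e) else 0

lemma localize_of_eq [Zero α] (e : ι → κ) (X : Matrix (ι → σ) (ι → σ) α) {a b : κ → σ}
    (h : ∀ l, l ∉ Set.range e → a l = b l) : localize e X a b = X (a ∘ e) (b ∘ e) := by
  simp only [localize, Matrix.of_apply]
  rw [if_pos h]

lemma localize_of_ne [Zero α] (e : ι → κ) (X : Matrix (ι → σ) (ι → σ) α) {a b : κ → σ}
    (h : ¬ ∀ l, l ∉ Set.range e → a l = b l) : localize e X a b = 0 := by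
  simp only [localize, Matrix.of_apply]
  rw [if_neg h]

lemma localize_mul [Semiring α] {e : ι → κ} (he : Function.Injective e)
    (X Y : Matrix (ι → σ) (ι → σ) α) :
    localize e (X * Y) = localize e X * localize e Y := by
  ext a b
  rw [Matrix.mul_apply]
  by_cases h : ∀ l, l ∉ Set.range e → a l = b l
  · rw [localize_of_eq e _ h, Matrix.mul_apply]
    refine Finset.sum_of_injOn (fun d => Function.extend e d a) ?_ ?_ ?_ ?_
    · intro d _ d' _ hd
      funext i
      have := congrFun hd (e i)
      simpa [he.extend_apply] using this
    · intro _ _; simp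
    · intro c _ hc
      by_cases hac : ∀ l, l ∉ Set.range e → a l = c l
      · refine absurd ⟨c ∘ e, by simp, ?_⟩ hc
        funext l
        by_cases hl : l ∈ Set.range e
        · obtain ⟨i, rfl⟩ := hl
          simp [he.extend_apply]
        · change Function.extend e (c ∘ e) a l = c l
          rw [Function.extend_apply' _ _ _ hl, hac l hl]
      · rw [localize_of_ne e X hac, zero_mul]
    · intro d _
      have h1 : ∀ l, l ∉ Set.range e → a l = Function.extend e d a l := fun l hl => by
        rw [Function.extend_apply' _ _ _ hl]
      have h2 : ∀ l, l ∉ Set.range e → Function.extend e d a l = b l := fun l hl => by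
        rw [← h1 l hl, h l hl]
      have h3 : Function.extend e d a ∘ e = d := funext fun i => he.extend_apply d a i
      rw [localize_of_eq e X h1, localize_of_eq e Y h2, h3]
  · rw [localize_of_ne e _ h]
    refine (Finset.sum_eq_zero fun c _ => ?_).symm
    by_cases hac : ∀ l, l ∉ Set.range e → a l = c l
    · have hcb : ¬ ∀ l, l ∉ Set.range e → c l = b l := fun hcb =>
        h fun l hl => (hac l hl).trans (hcb l hl)
      rw [localize_of_ne e Y hcb, mul_zero]
    · rw [localize_of_ne e X hac, zero_mul]

lemma localize_diagonal [Zero α] (e : ι → κ) (s : α) :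
    localize (σ := σ) e (Matrix.diagonal fun _ => s) = Matrix.diagonal fun _ => s := by
  ext a b
  by_cases hab : a = b
  · subst hab
    rw [localize_of_eq e _ (fun _ _ => rfl), Matrix.diagonal_apply_eq, Matrix.diagonal_apply_eq]
  · rw [Matrix.diagonal_apply_ne _ hab]
    by_cases h : ∀ l, l ∉ Set.range e → a l = b l
    · rw [localize_of_eq e _ h]
      refine Matrix.diagonal_apply_ne _ fun hc => hab ?_
      funext l
      by_cases hl : l ∈ Set.range e
      · obtain ⟨i, rfl⟩ := hl
        exact congrFun hc i
      · exact h l hl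
    · rw [localize_of_ne e _ h]

lemma localize_one [Zero α] [One α] (e : ι → κ) :
    localize (σ := σ) (α := α) e 1 = 1 :=
  localize_diagonal e 1

lemma localize_add [AddZeroClass α] (e : ι → κ) (X Y : Matrix (ι → σ) (ι → σ) α) :
    localize e (X + Y) = localize e X + localize e Y := by
  ext a b
  by_cases h : ∀ l, l ∉ Set.range e → a l = b l
  · simp [localize_of_eq e _ h]
  · simp [localize_of_ne e _ h]

lemma localize_zero [Zero α] (e : ι → κ) :
    localize (σ := σ) (α := α) e 0 = 0 := by
  ext a b
  by_cases h : ∀ l, l ∉ Set.range e → a l = b l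
  · simp [localize_of_eq e _ h]
  · simp [localize_of_ne e _ h]

/-- `localize` along an injection as an algebra homomorphism. -/
def localizeHom [Semiring α] [Algebra ℂ α] (e : ι → κ) (he : Function.Injective e) :
    Matrix (ι → σ) (ι → σ) α →ₐ[ℂ] Matrix (κ → σ) (κ → σ) α where
  toFun := localize e
  map_one' := localize_one e
  map_mul' := localize_mul he
  map_zero' := localize_zero e
  map_add' := localize_add e
  commutes' c := localize_diagonal e (algebraMap ℂ α c)

lemma localize_localize [Zero α] (e : κ → τ) (f : ι → κ) (he : Function.Injective e)
    (X : Matrix (ι → σ) (ι → σ) α) :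
    localize e (localize f X) = localize (e ∘ f) X := by
  ext a b
  by_cases h : ∀ l, l ∉ Set.range (e ∘ f) → a l = b l
  · rw [localize_of_eq _ _ h, localize_of_eq, localize_of_eq]
    · rfl
    · intro l hl
      refine h _ ?_
      rintro ⟨i, hi⟩
      exact hl ⟨i, he hi⟩
    · intro l hl
      refine h _ ?_
      rintro ⟨i, hi⟩
      exact hl ⟨f i, hi⟩
  · rw [localize_of_ne _ _ h]
    by_cases h1 : ∀ l, l ∉ Set.range e → a l = b l
    · rw [localize_of_eq _ _ h1]
      refine localize_of_ne _ _ fun h2 => h fun l hl => ?_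
      by_cases hle : l ∈ Set.range e
      · obtain ⟨j, rfl⟩ := hle
        refine h2 j ?_
        rintro ⟨i, rfl⟩
        exact hl ⟨i, rfl⟩
      · exact h1 l hle
    · rw [localize_of_ne _ _ h1]

lemma localize_mul_apply_of_disjoint [Semiring α] {e : ι → κ} {f : τ → κ}
    (he : Function.Injective e) (hef : ∀ i j, e i ≠ f j)
    (X : Matrix (ι → σ) (ι → σ) α) (Y : Matrix (τ → σ) (τ → σ) α) (a b : κ → σ)
    [Decidable (∀ l, l ∉ Set.range e → l ∉ Set.range f → a l = b l)] :
    (localize e X * localize f Y) a b =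
      if ∀ l, l ∉ Set.range e → l ∉ Set.range f → a l = b l then
        X (a ∘ e) (b ∘ e) * Y (a ∘ f) (b ∘ f) else 0 := by
  rw [Matrix.mul_apply, Finset.sum_eq_single (Function.extend e (b ∘ e) a)]
  · have h1 : ∀ l, l ∉ Set.range e → a l = Function.extend e (b ∘ e) a l := fun l hl => by
      rw [Function.extend_apply' _ _ _ hl]
    have h3 : Function.extend e (b ∘ e) a ∘ e = b ∘ e := funext fun i => he.extend_apply _ a i
    have h4 : Function.extend e (b ∘ e) a ∘ f = a ∘ f := funext fun j => by
      refine (h1 (f j) ?_).symm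
      rintro ⟨i, hi⟩
      exact hef i j hi
    rw [localize_of_eq e X h1, h3]
    split_ifs with h
    · rw [localize_of_eq f Y, h4]
      intro l hl
      by_cases hle : l ∈ Set.range e
      · obtain ⟨i, rfl⟩ := hle
        exact congrFun h3 i
      · rw [← h1 l hle, h l hle hl]
    · rw [localize_of_ne f Y, mul_zero]
      intro hc
      refine h fun l hle hlf => ?_
      rw [h1 l hle, hc l hlf]
  · intro c _ hc
    by_cases hac : ∀ l, l ∉ Set.range e → a l = c l
    · by_cases hcb : ∀ l, l ∉ Set.range f → c l = b l
      · refine absurd (funext fun l => ?_) hc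
        by_cases hle : l ∈ Set.range e
        · obtain ⟨i, rfl⟩ := hle
          rw [he.extend_apply]
          refine hcb _ ?_
          rintro ⟨j, hj⟩
          exact hef i j hj.symm
        · rw [Function.extend_apply' _ _ _ hle, hac l hle]
      · rw [localize_of_ne f Y hcb, mul_zero]
    · rw [localize_of_ne e X hac, zero_mul]
  · simp

lemma localize_commute [Semiring α] {e : ι → κ} {f : τ → κ}
    (he : Function.Injective e) (hf : Function.Injective f) (hef : ∀ i j, e i ≠ f j)
    (X : Matrix (ι → σ) (ι → σ) α) (Y : Matrix (τ → σ) (τ → σ) α)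
    (hXY : ∀ a b c d, Commute (X a b) (Y c d)) :
    Commute (localize e X) (localize f Y) := by
  classical
  refine Matrix.ext fun a b => ?_
  rw [localize_mul_apply_of_disjoint he hef, localize_mul_apply_of_disjoint hf
    (fun i j => (hef j i).symm)]
  have : (∀ l, l ∉ Set.range e → l ∉ Set.range f → a l = b l) ↔
      (∀ l, l ∉ Set.range f → l ∉ Set.range e → a l = b l) :=
    forall_congr' fun l => ⟨fun h x y => h y x, fun h x y => h y x⟩
  simp only [this, (hXY _ _ _ _).eq]

end LocalEmbedding

section Sites

variable {α : Type*} [Semiring α] {N : ℕ}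

lemma opAt_eq_localize {k i : ℕ} (R : Matrix (Fin N × Fin N) (Fin N × Fin N) α)
    (h : i + 1 < k) :
    opAt N k R i = localize (![⟨i, by omega⟩, ⟨i + 1, h⟩] : Fin 2 → Fin k) (opAt N 2 R 0) := by
  have key : ∀ l : Fin k, l ∉ Set.range (![⟨i, by omega⟩, ⟨i + 1, h⟩] : Fin 2 → Fin k) ↔
      ((l : ℕ) ≠ i ∧ (l : ℕ) ≠ i + 1) := by
    intro l
    simp only [Set.mem_range, Fin.exists_fin_two, Matrix.cons_val_zero, Matrix.cons_val_one,
      Fin.ext_iff]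
    omega
  ext a b
  by_cases hab : ∀ l, l ∉ Set.range (![⟨i, by omega⟩, ⟨i + 1, h⟩] : Fin 2 → Fin k) → a l = b l
  · rw [localize_of_eq _ _ hab]
    have h' : ∀ l : Fin k, (l : ℕ) ≠ i → (l : ℕ) ≠ i + 1 → a l = b l := fun l h1 h2 =>
      hab l ((key l).2 ⟨h1, h2⟩)
    simp only [opAt, h, dite_true, Matrix.of_apply, if_pos h']
    rw [dif_pos (by omega), Matrix.of_apply, if_pos (fun l h1 h2 => by omega)]
    rfl
  · rw [localize_of_ne _ _ hab]
    have h' : ¬ ∀ l : Fin k, (l : ℕ) ≠ i → (l : ℕ) ≠ i + 1 → a l = b l := fun hc =>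
      hab fun l hl => hc l ((key l).1 hl).1 ((key l).1 hl).2
    simp only [opAt, h, dite_true, Matrix.of_apply, if_neg h']

lemma opAt_of_le {k i : ℕ} (R : Matrix (Fin N × Fin N) (Fin N × Fin N) α)
    (h : ¬ i + 1 < k) : opAt N k R i = 1 := dif_neg h

lemma matAt_eq_localize {k i : ℕ} (X : Matrix (Fin N) (Fin N) α) (h : i < k) :
    matAt N k X i = localize (![⟨i, h⟩] : Fin 1 → Fin k) (matAt N 1 X 0) := by
  have key : ∀ l : Fin k, l ∉ Set.range (![⟨i, h⟩] : Fin 1 → Fin k) ↔ (l : ℕ) ≠ i := by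
    intro l
    simp [Fin.ext_iff, eq_comm]
  ext a b
  by_cases hab : ∀ l, l ∉ Set.range (![⟨i, h⟩] : Fin 1 → Fin k) → a l = b l
  · rw [localize_of_eq _ _ hab]
    have h' : ∀ l : Fin k, (l : ℕ) ≠ i → a l = b l := fun l h1 => hab l ((key l).2 h1)
    simp only [matAt, h, dite_true, Matrix.of_apply, if_pos h']
    rw [dif_pos (by omega), Matrix.of_apply, if_pos (fun l h1 => by omega)]
    rfl
  · rw [localize_of_ne _ _ hab]
    have h' : ¬ ∀ l : Fin k, (l : ℕ) ≠ i → a l = b l := fun hc =>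
      hab fun l hl => hc l ((key l).1 hl)
    simp only [matAt, h, dite_true, Matrix.of_apply, if_neg h']

lemma pair_injective {k i : ℕ} (h : i + 1 < k) :
    Function.Injective (![⟨i, by omega⟩, ⟨i + 1, h⟩] : Fin 2 → Fin k) := by
  intro x y hxy
  fin_cases x <;> fin_cases y <;> simp_all

lemma localize_opAt {k m i j : ℕ} (e : Fin k → Fin m) (he : Function.Injective e)
    (R : Matrix (Fin N × Fin N) (Fin N × Fin N) α) (h : i + 1 < k) (h' : j + 1 < m)
    (h0 : (e ⟨i, by omega⟩ : ℕ) = j) (h1 : (e ⟨i + 1, h⟩ : ℕ) = j + 1) :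
    localize e (opAt N k R i) = opAt N m R j := by
  rw [opAt_eq_localize R h, opAt_eq_localize R h', localize_localize e _ he]
  congr 1
  funext x
  fin_cases x <;> simp [Fin.ext_iff, h0, h1]

lemma localize_matAt {k m i j : ℕ} (e : Fin k → Fin m) (he : Function.Injective e)
    (X : Matrix (Fin N) (Fin N) α) (h : i < k) (h' : j < m)
    (h0 : (e ⟨i, h⟩ : ℕ) = j) :
    localize e (matAt N k X i) = matAt N m X j := by
  rw [matAt_eq_localize X h, matAt_eq_localize X h', localize_localize e _ he]
  congr 1
  funext x
  fin_cases x
  simp [Fin.ext_iff, h0]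

lemma opAt_two (R : Matrix (Fin N × Fin N) (Fin N × Fin N) α) :
    opAt N 2 R 0 = R.submatrix (finTwoArrowEquiv (Fin N)) (finTwoArrowEquiv (Fin N)) := by
  ext a b
  rw [opAt, dif_pos (by omega), Matrix.of_apply, if_pos (fun l h1 h2 => by omega)]
  rfl

lemma matAt_one_site (X : Matrix (Fin N) (Fin N) α) :
    matAt N 1 X 0 = X.submatrix (Equiv.funUnique (Fin 1) (Fin N))
      (Equiv.funUnique (Fin 1) (Fin N)) := by
  ext a b
  rw [matAt, dif_pos (by omega), Matrix.of_apply, if_pos (fun l h1 => by omega)]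
  rfl

lemma opAt_mul (k i : ℕ) (R S : Matrix (Fin N × Fin N) (Fin N × Fin N) α) :
    opAt N k (R * S) i = opAt N k R i * opAt N k S i := by
  by_cases h : i + 1 < k
  · rw [opAt_eq_localize _ h, opAt_eq_localize _ h, opAt_eq_localize _ h,
      ← localize_mul (pair_injective h), opAt_two, opAt_two, opAt_two,
      Matrix.submatrix_mul_equiv]
  · simp [opAt_of_le _ h]

lemma opAt_one (k i : ℕ) :
    opAt N k (1 : Matrix (Fin N × Fin N) (Fin N × Fin N) α) i = 1 := by
  by_cases h : i + 1 < k
  · rw [opAt_eq_localize _ h, opAt_two, Matrix.submatrix_one_equiv, localize_one]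
  · exact opAt_of_le _ h

lemma opAt_add {k i : ℕ} (h : i + 1 < k) (R S : Matrix (Fin N × Fin N) (Fin N × Fin N) α) :
    opAt N k (R + S) i = opAt N k R i + opAt N k S i := by
  rw [opAt_eq_localize _ h, opAt_eq_localize _ h, opAt_eq_localize _ h, ← localize_add,
    opAt_two, opAt_two, opAt_two]
  rfl

lemma matAt_mul {k i : ℕ} (h : i < k) (X Y : Matrix (Fin N) (Fin N) α) :
    matAt N k (X * Y) i = matAt N k X i * matAt N k Y i := by
  rw [matAt_eq_localize _ h, matAt_eq_localize _ h, matAt_eq_localize _ h,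
    ← localize_mul (Function.injective_of_subsingleton _), matAt_one_site, matAt_one_site,
    matAt_one_site, Matrix.submatrix_mul_equiv]

lemma matAt_one (k i : ℕ) : matAt N k (1 : Matrix (Fin N) (Fin N) α) i = 1 := by
  by_cases h : i < k
  · rw [matAt_eq_localize _ h, matAt_one_site, Matrix.submatrix_one_equiv, localize_one]
  · exact dif_neg h

lemma matAt_add {k i : ℕ} (h : i < k) (X Y : Matrix (Fin N) (Fin N) α) :
    matAt N k (X + Y) i = matAt N k X i + matAt N k Y i := by
  rw [matAt_eq_localize _ h, matAt_eq_localize _ h, matAt_eq_localize _ h, ← localize_add,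
    matAt_one_site, matAt_one_site, matAt_one_site]
  rfl

variable {A : Type*} [Ring A] [Algebra ℂ A]

lemma opAt_toA (k i : ℕ) (R : Matrix (Fin N × Fin N) (Fin N × Fin N) ℂ) :
    opAt N k (toA A R) i = toA A (opAt N k R i) := by
  by_cases h : i + 1 < k
  · ext a b
    simp only [opAt, h, dite_true, toA, Matrix.of_apply, Matrix.map_apply]
    split_ifs <;> simp
  · rw [opAt_of_le _ h, opAt_of_le _ h, toA, Matrix.map_one _ (map_zero _) (map_one _)]

lemma toA_mul {ι : Type*} [Fintype ι] (X Y : Matrix ι ι ℂ) :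
    toA A (X * Y) = toA A X * toA A Y := Matrix.map_mul

lemma toA_one {ι : Type*} [DecidableEq ι] :
    toA A (1 : Matrix ι ι ℂ) = 1 := Matrix.map_one _ (map_zero _) (map_one _)

lemma opAt_commute_opAt (k : ℕ) (R S : Matrix (Fin N × Fin N) (Fin N × Fin N) ℂ) {i j : ℕ}
    (hij : i + 2 ≤ j) : Commute (opAt N k (toA A R) i) (opAt N k (toA A S) j) := by
  by_cases h : j + 1 < k
  · rw [opAt_eq_localize _ (by omega : i + 1 < k), opAt_eq_localize _ h]
    refine localize_commute (pair_injective _) (pair_injective _) ?_ _ _ ?_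
    · intro x y
      fin_cases x <;> fin_cases y <;> simp [Fin.ext_iff] <;> omega
    · intro a b c d
      rw [opAt_toA]
      exact Algebra.commutes _ _
  · rw [opAt_of_le _ h]
    exact Commute.one_right _

lemma matAt_commute_opAt (k : ℕ) (X : Matrix (Fin N) (Fin N) A)
    (S : Matrix (Fin N × Fin N) (Fin N × Fin N) ℂ) {j : ℕ} (hj : 1 ≤ j) :
    Commute (matAt N k X 0) (opAt N k (toA A S) j) := by
  by_cases h : j + 1 < k
  · rw [matAt_eq_localize _ (by omega : 0 < k), opAt_eq_localize _ h]
    refine localize_commute (Function.injective_of_subsingleton _) (pair_injective _) ?_ _ _ ?_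
    · intro x y
      fin_cases x; fin_cases y <;> simp [Fin.ext_iff] <;> omega
    · intro a b c d
      rw [opAt_toA]
      exact (Algebra.commutes _ _).symm
  · rw [opAt_of_le _ h]
    exact Commute.one_right _

lemma opAt_braid {k i : ℕ} {R : Matrix (Fin N × Fin N) (Fin N × Fin N) ℂ} (hR : IsBraid N R)
    (h : i + 2 < k) :
    opAt N k (toA A R) i * opAt N k (toA A R) (i + 1) * opAt N k (toA A R) i =
      opAt N k (toA A R) (i + 1) * opAt N k (toA A R) i * opAt N k (toA A R) (i + 1) := by
  let e : Fin 3 → Fin k := fun l => ⟨i + l, by omega⟩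
  have he : Function.Injective e := fun x y hxy => by
    simp only [e, Fin.mk.injEq] at hxy
    omega
  have h0 : localize e (opAt N 3 (toA A R) 0) = opAt N k (toA A R) i :=
    localize_opAt e he _ (by omega) (by omega) rfl rfl
  have h1 : localize e (opAt N 3 (toA A R) 1) = opAt N k (toA A R) (i + 1) :=
    localize_opAt e he _ (by omega) (by omega) rfl rfl
  rw [← h0, ← h1]
  simp only [← localize_mul he, opAt_toA, ← toA_mul]
  rw [show opAt N 3 R 0 * opAt N 3 R 1 * opAt N 3 R 0 = _ from hR]

end Sites

section BraidSequences

variable {B : Type*} [Ring B]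

/-- A sequence `g 0, g 1, …` of units with inverses `h i`, commuting when the indices are not
adjacent, and satisfying the braid relations for indices `i + 1 < k - 1`. -/
structure IsBraidSeq (k : ℕ) (g h : ℕ → B) : Prop where
  mul_inv : ∀ i, g i * h i = 1
  inv_mul : ∀ i, h i * g i = 1
  far : ∀ i j, i + 2 ≤ j → Commute (g i) (g j)
  braid : ∀ i, i + 2 < k → g i * g (i + 1) * g i = g (i + 1) * g i * g (i + 1)

/-- Overline copies along a sequence of units. -/
def ovSeq (g h : ℕ → B) (x : B) : ℕ → B
  | 0 => x
  | r + 1 => g r * ovSeq g h x r * h r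

/-- Underline copies along a sequence of units. -/
def unSeq (g h : ℕ → B) (x : B) : ℕ → B
  | 0 => x
  | r + 1 => h r * unSeq g h x r * g r

/-- The ordered product of the first `n` overline copies. -/
def ovSeqProd (g h : ℕ → B) (x : B) (n : ℕ) : B := ((List.range n).map (ovSeq g h x)).prod

/-- The descending product `g (m - 1) ⋯ g 0`. -/
def descProd (g : ℕ → B) : ℕ → B
  | 0 => 1
  | m + 1 => g m * descProd g m

/-- The ascending product `h 0 ⋯ h (m - 1)`. -/
def ascProd (h : ℕ → B) : ℕ → B
  | 0 => 1
  | m + 1 => ascProd h m * h m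

/-- The element `h (m - 1) ⋯ h 0 h 0 ⋯ h (m - 1)`. -/
def palProd (h : ℕ → B) : ℕ → B
  | 0 => 1
  | m + 1 => h m * palProd h m * h m

lemma ovSeqProd_succ (g h : ℕ → B) (x : B) (n : ℕ) :
    ovSeqProd g h x (n + 1) = ovSeqProd g h x n * ovSeq g h x n := by
  simp [ovSeqProd, List.range_succ]

namespace IsBraidSeq

variable {k : ℕ} {g h : ℕ → B} (hg : IsBraidSeq k g h)

include hg

lemma commute_inv_right {y : B} {j : ℕ} (hy : Commute y (g j)) : Commute y (h j) := by
  have : y * h j = h j * y := by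
    calc y * h j = h j * (g j * y) * h j := by rw [← mul_assoc, hg.inv_mul, one_mul]
      _ = h j * (y * g j) * h j := by rw [hy.eq]
      _ = h j * y := by rw [mul_assoc, mul_assoc, hg.mul_inv, mul_one]
  exact this

lemma ascProd_mul_descProd (m : ℕ) : ascProd h m * descProd g m = 1 := by
  induction m with
  | zero => simp [ascProd, descProd]
  | succ m ih =>
    rw [ascProd, descProd, mul_assoc, ← mul_assoc (h m), hg.inv_mul, one_mul, ih]

lemma commute_ovSeq {x : B} (hx : ∀ j, 1 ≤ j → Commute x (g j)) (r : ℕ) :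
    ∀ j, r < j → Commute (ovSeq g h x r) (g j) := by
  induction r with
  | zero => exact fun j hj => hx j hj
  | succ r ih =>
    intro j hj
    have h1 : Commute (g r) (g j) := hg.far r j (by omega)
    have h2 : Commute (h r) (g j) := (hg.commute_inv_right h1.symm).symm
    exact (h1.mul_left (ih j (by omega))).mul_left h2

lemma commute_unSeq {x : B} (hx : ∀ j, 1 ≤ j → Commute x (g j)) (r : ℕ) :
    ∀ j, r < j → Commute (unSeq g h x r) (g j) := by
  induction r with
  | zero => exact fun j hj => hx j hj
  | succ r ih =>
    intro j hj
    have h1 : Commute (g r) (g j) := hg.far r j (by omega)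
    have h2 : Commute (h r) (g j) := (hg.commute_inv_right h1.symm).symm
    exact (h2.mul_left (ih j (by omega))).mul_left h1

lemma commute_ovSeqProd {x : B} (hx : ∀ j, 1 ≤ j → Commute x (g j)) (n : ℕ) :
    ∀ j, n ≤ j → Commute (ovSeqProd g h x n) (g j) := by
  induction n with
  | zero => exact fun j _ => by simp [ovSeqProd]
  | succ n ih =>
    intro j hj
    rw [ovSeqProd_succ]
    exact (ih j (by omega)).mul_left (hg.commute_ovSeq hx n j hj)

lemma commute_descProd (m : ℕ) : ∀ j, m < j → Commute (descProd g m) (g j) := by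
  induction m with
  | zero => exact fun j _ => Commute.one_left _
  | succ m ih =>
    intro j hj
    exact (hg.far m j (by omega)).mul_left (ih j (by omega))

lemma semiconj_mul_succ {i : ℕ} (hi : i + 2 < k) :
    SemiconjBy (g i * g (i + 1)) (g i) (g (i + 1)) := by
  rw [SemiconjBy, hg.braid i hi, mul_assoc]

lemma inv_of_semiconj {u a b : B} {i j : ℕ} (hu : SemiconjBy u a b) (hai : a = g i)
    (hbj : b = g j) : SemiconjBy u (h i) (h j) := by
  subst hai hbj
  have : u * h i = h j * u := by
    calc u * h i = h j * (g j * u) * h i := by rw [← mul_assoc, hg.inv_mul, one_mul]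
      _ = h j * (u * g i) * h i := by rw [hu.eq]
      _ = h j * u := by rw [mul_assoc, mul_assoc, hg.mul_inv, mul_one]
  exact this

/-- Later underline copies commute with the earlier generators. -/
lemma commute_unSeq_of_lt {x : B} (hx : ∀ j, 1 ≤ j → Commute x (g j)) (r : ℕ) (hr : r < k) :
    ∀ i, i + 1 < r → Commute (unSeq g h x r) (g i) := by
  induction r with
  | zero => intro i hi; omega
  | succ r ih =>
    intro i hi
    by_cases hir : i + 1 < r
    · have h1 : Commute (g i) (g r) := hg.far i r (by omega)
      exact ((hg.commute_inv_right h1).symm.mul_left (ih (by omega) i hir)).mul_left h1.symm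
    · obtain rfl : r = i + 1 := by omega
      have e1 : SemiconjBy (g i * g (i + 1)) (g i) (g (i + 1)) :=
        hg.semiconj_mul_succ (by omega)
      have e2 : SemiconjBy (unSeq g h x i) (g (i + 1)) (g (i + 1)) :=
        hg.commute_unSeq hx i _ (by omega)
      have e3 : SemiconjBy (h (i + 1) * h i) (g (i + 1)) (g i) := by
        have hinv : (h (i + 1) * h i) * (g i * g (i + 1)) = 1 := by
          rw [mul_assoc, ← mul_assoc (h i), hg.inv_mul, one_mul, hg.inv_mul]
        have hinv' : (g i * g (i + 1)) * (h (i + 1) * h i) = 1 := by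
          rw [mul_assoc, ← mul_assoc (g (i + 1)), hg.mul_inv, one_mul, hg.mul_inv]
        rw [SemiconjBy]
        calc h (i + 1) * h i * g (i + 1)
            = h (i + 1) * h i * (g (i + 1) * (g i * g (i + 1))) * (h (i + 1) * h i) := by
              rw [mul_assoc, mul_assoc, mul_assoc, mul_assoc, hinv', mul_one]
          _ = (h (i + 1) * h i * (g i * g (i + 1))) * g i * (h (i + 1) * h i) := by
              rw [← e1.eq]; simp only [mul_assoc]
          _ = g i * (h (i + 1) * h i) := by rw [hinv, one_mul]
      have e4 := (e3.mul_left e2).mul_left e1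
      have e5 : unSeq g h x (i + 1 + 1) =
          h (i + 1) * h i * unSeq g h x i * (g i * g (i + 1)) := by
        simp only [unSeq, mul_assoc]
      rw [e5]
      exact e4

/-- Conjugation by `g (m - 1) ⋯ g 0` shifts the generators by one. -/
lemma mul_descProd (m : ℕ) (hm : m < k) :
    ∀ i, i + 1 < m → g i * descProd g m = descProd g m * g (i + 1) := by
  induction m with
  | zero => intro i hi; omega
  | succ m ih =>
    intro i hi
    rw [descProd]
    by_cases him : i + 1 < m
    · rw [← mul_assoc, (hg.far i m (by omega)).eq, mul_assoc, ih (by omega) i him, mul_assoc]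
    · obtain rfl : m = i + 1 := by omega
      rw [descProd, mul_assoc, mul_assoc, (hg.commute_descProd i (i + 1) (by omega)).eq,
        ← mul_assoc, ← mul_assoc, hg.braid i (by omega)]
      simp only [mul_assoc]

lemma unSeq_mul_descProd {x : B} (hx : ∀ j, 1 ≤ j → Commute x (g j)) (m : ℕ) (hm : m < k) :
    ∀ r, r < m → unSeq g h x r * descProd g m = descProd g m * unSeq g h x (r + 1) := by
  intro r
  induction r with
  | zero =>
    intro h0
    obtain ⟨m, rfl⟩ : ∃ m', m = m' + 1 := ⟨m - 1, by omega⟩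
    clear hm h0
    induction m with
    | zero =>
      simp only [unSeq, descProd, mul_one]
      rw [← mul_assoc, ← mul_assoc, hg.mul_inv, one_mul]
    | succ m ih =>
      rw [descProd, ← mul_assoc, (show Commute (unSeq g h x 0) (g (m + 1)) from
        hx (m + 1) (by omega)).eq, mul_assoc, ih, mul_assoc]
  | succ r ih =>
    intro hr
    have e1 := hg.mul_descProd m hm r hr
    have e2 : h r * descProd g m = descProd g m * h (r + 1) :=
      (hg.inv_of_semiconj (show SemiconjBy (descProd g m) (g (r + 1)) (g r) from e1.symm)
        rfl rfl).eq.symm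
    rw [unSeq, unSeq, mul_assoc, e1, ← mul_assoc, mul_assoc (h r), ih (by omega), ← mul_assoc,
      e2]
    simp only [mul_assoc]

/-- The exchange relation for the first copies propagates to all overline copies. -/
lemma ovSeq_exchange {x y : B} (hx : ∀ j, 1 ≤ j → Commute x (g j))
    (hy : ∀ j, 1 ≤ j → Commute y (g j))
    (hxy : 1 < k → x * g 0 * y * g 0 = h 0 * y * g 0 * x) (n : ℕ) (hn : n + 1 < k) :
    ovSeq g h x n * g n * ovSeq g h y n * g n =
      h n * ovSeq g h y n * g n * ovSeq g h x n := by
  induction n with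
  | zero => exact hxy hn
  | succ n ih =>
    have e1 : SemiconjBy (g n * g (n + 1)) (g n) (g (n + 1)) :=
      hg.semiconj_mul_succ (by omega)
    have e1' := hg.inv_of_semiconj e1 rfl rfl
    have e2 : ∀ z : B, (∀ j, 1 ≤ j → Commute z (g j)) →
        SemiconjBy (g n * g (n + 1)) (ovSeq g h z n) (ovSeq g h z (n + 1)) := by
      intro z hz
      refine SemiconjBy.mul_left ?_ (hg.commute_ovSeq hz n (n + 1) (by omega)).symm
      rw [SemiconjBy, ovSeq, mul_assoc, mul_assoc, hg.inv_mul, mul_one]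
    have l := (((e2 x hx).mul_right e1).mul_right (e2 y hy)).mul_right e1
    have r := ((e1'.mul_right (e2 y hy)).mul_right e1).mul_right (e2 x hx)
    rw [← ih (by omega)] at r
    have hinv : (g n * g (n + 1)) * (h (n + 1) * h n) = 1 := by
      rw [mul_assoc, ← mul_assoc (g (n + 1)), hg.mul_inv, one_mul, hg.mul_inv]
    have := congrArg (· * (h (n + 1) * h n)) (l.eq.symm.trans r.eq)
    simpa only [mul_assoc _ (g n * g (n + 1)) _, hinv, mul_one] using this

lemma unSeq_mul_ovSeqProd {x y : B} (hx : ∀ j, 1 ≤ j → Commute x (g j))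
    (hy : ∀ j, 1 ≤ j → Commute y (g j))
    (hxy : 1 < k → x * g 0 * y * g 0 = h 0 * y * g 0 * x) (n : ℕ) (hn : n < k) :
    unSeq g h x n * ovSeqProd g h y n =
      palProd h n * ovSeqProd g h y n * ovSeq g h x n := by
  induction n with
  | zero => simp [ovSeqProd, palProd, unSeq, ovSeq]
  | succ n ih =>
    have e1 := hg.commute_ovSeqProd hy n n le_rfl
    have e1' := hg.commute_inv_right e1
    have e2 := hg.ovSeq_exchange hx hy hxy n hn
    have e3 : ovSeq g h x n * g n * ovSeq g h y n =
        h n * ovSeq g h y n * ovSeq g h x (n + 1) := by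
      have := congrArg (· * h n) e2
      simp only [mul_assoc _ (g n) (h n), hg.mul_inv, mul_one] at this
      rw [this, ovSeq]
      simp only [mul_assoc]
    calc unSeq g h x (n + 1) * ovSeqProd g h y (n + 1)
        = h n * unSeq g h x n * (g n * ovSeqProd g h y n) * ovSeq g h y n := by
          rw [unSeq, ovSeqProd_succ]; simp only [mul_assoc]
      _ = h n * (unSeq g h x n * ovSeqProd g h y n) * g n * ovSeq g h y n := by
          rw [← e1.eq]; simp only [mul_assoc]
      _ = h n * palProd h n * ovSeqProd g h y n * (ovSeq g h x n * g n * ovSeq g h y n) := by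
          rw [ih (by omega)]; simp only [mul_assoc]
      _ = h n * palProd h n * (ovSeqProd g h y n * h n) * ovSeq g h y n *
            ovSeq g h x (n + 1) := by
          rw [e3]; simp only [mul_assoc]
      _ = palProd h (n + 1) * ovSeqProd g h y (n + 1) * ovSeq g h x (n + 1) := by
          rw [e1'.eq, palProd, ovSeqProd_succ]; simp only [mul_assoc]

end IsBraidSeq

variable [Algebra ℂ B]

/-- Left multiplication by the generators suffices to bound a generated subalgebra. -/
lemma adjoin_le_of_mul_mem (s : Set B) (S : Submodule ℂ B) (h1 : 1 ∈ S)
    (hs : ∀ x ∈ s, ∀ y ∈ S, x * y ∈ S) {x : B} (hx : x ∈ Algebra.adjoin ℂ s) : x ∈ S := by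
  have : ∀ y ∈ S, x * y ∈ S := by
    induction hx using Algebra.adjoin_induction with
    | mem x hx => exact hs x hx
    | algebraMap c =>
      intro y hy
      rw [← Algebra.smul_def]
      exact S.smul_mem c hy
    | add x y _ _ ihx ihy =>
      intro z hz
      rw [add_mul]
      exact S.add_mem (ihx z hz) (ihy z hz)
    | mul x y _ _ ihx ihy =>
      intro z hz
      rw [mul_assoc]
      exact ihx _ (ihy z hz)
  simpa using this 1 h1

/-- The subalgebra generated by `g 0, …, g (n - 2)`. -/
def braidAlg (g : ℕ → B) (n : ℕ) : Subalgebra ℂ B :=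
  Algebra.adjoin ℂ {x | ∃ i, i + 1 < n ∧ x = g i}

lemma mem_braidAlg (g : ℕ → B) {n i : ℕ} (hi : i + 1 < n) : g i ∈ braidAlg g n :=
  Algebra.subset_adjoin ⟨i, hi, rfl⟩

lemma braidAlg_mono (g : ℕ → B) {m n : ℕ} (h : m ≤ n) : braidAlg g m ≤ braidAlg g n :=
  Algebra.adjoin_mono fun _ ⟨i, hi, hx⟩ => ⟨i, hi.trans_le h, hx⟩

lemma commute_of_mem_braidAlg {g : ℕ → B} {n : ℕ} {x y : B}
    (hx : ∀ i, i + 1 < n → Commute x (g i)) (hy : y ∈ braidAlg g n) : Commute x y := by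
  induction hy using Algebra.adjoin_induction with
  | mem y hy => obtain ⟨i, hi, rfl⟩ := hy; exact hx i hi
  | algebraMap c => exact (Algebra.commutes c x).symm
  | add y z _ _ ihy ihz => exact ihy.add_right ihz
  | mul y z _ _ ihy ihz => exact ihy.mul_right ihz

/-- The Hecke algebra decomposition `H_{n+1} = H_n + H_n g_n H_n`. -/
lemma IsBraidSeq.mem_span_of_mem_braidAlg {k : ℕ} {g h : ℕ → B} (hg : IsBraidSeq k g h)
    (c : ℂ) (hc : ∀ i, i + 1 < k → g i * g i = 1 + c • g i) (n : ℕ) (hn : n + 1 < k) :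
    ∀ x ∈ braidAlg g (n + 2), x ∈ Submodule.span ℂ
      {x | x ∈ braidAlg g (n + 1) ∨
        ∃ a ∈ braidAlg g (n + 1), ∃ b ∈ braidAlg g (n + 1), x = a * g n * b} := by
  induction n with
  | zero =>
    intro x hx
    refine adjoin_le_of_mul_mem _ _ ?_ ?_ hx
    · exact Submodule.subset_span (Or.inl (one_mem _))
    rintro _ ⟨i, hi, rfl⟩ y hy
    obtain rfl : i = 0 := by omega
    have hbot : ∀ a ∈ braidAlg g 1, Commute (g 0) a := fun a ha =>
      commute_of_mem_braidAlg (fun i hi => by omega) ha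
    induction hy using Submodule.span_induction with
    | mem y hy =>
      rcases hy with hy | ⟨a, ha, b, hb, rfl⟩
      · exact Submodule.subset_span (Or.inr ⟨1, one_mem _, y, hy, by rw [one_mul]⟩)
      · have : g 0 * (a * g 0 * b) = a * b + c • (a * g 0 * b) := by
          rw [← mul_assoc, ← mul_assoc, (hbot a ha).eq, mul_assoc a, hc 0 (by omega), mul_add,
            mul_one, add_mul, mul_smul_comm, smul_mul_assoc]
        rw [this]
        exact add_mem (Submodule.subset_span (Or.inl (mul_mem ha hb)))
          (Submodule.smul_mem _ _ (Submodule.subset_span (Or.inr ⟨a, ha, b, hb, rfl⟩)))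
    | zero => simp
    | add y z _ _ ihy ihz => rw [mul_add]; exact add_mem ihy ihz
    | smul d y _ ih => rw [mul_smul_comm]; exact Submodule.smul_mem _ _ ih
  | succ n ih =>
    intro x hx
    refine adjoin_le_of_mul_mem _ _ ?_ ?_ hx
    · exact Submodule.subset_span (Or.inl (one_mem _))
    rintro _ ⟨i, hi, rfl⟩ y hy
    induction hy using Submodule.span_induction with
    | zero => simp
    | add y z _ _ ihy ihz => rw [mul_add]; exact add_mem ihy ihz
    | smul d y _ ih => rw [mul_smul_comm]; exact Submodule.smul_mem _ _ ih
    | mem y hy =>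
      by_cases hin : i + 1 < n + 2
      · have hgi := mem_braidAlg g hin
        rcases hy with hy | ⟨a, ha, b, hb, rfl⟩
        · exact Submodule.subset_span (Or.inl (mul_mem hgi hy))
        · refine Submodule.subset_span (Or.inr ⟨g i * a, mul_mem hgi ha, b, hb, ?_⟩)
          simp only [mul_assoc]
      · obtain rfl : i = n + 1 := by omega
        rcases hy with hy | ⟨a, ha, b, hb, rfl⟩
        · exact Submodule.subset_span (Or.inr ⟨1, one_mem _, y, hy, by rw [one_mul]⟩)
        · have hcomm : ∀ a ∈ braidAlg g (n + 1), Commute (g (n + 1)) a := fun a ha =>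
            commute_of_mem_braidAlg (fun i hi => (hg.far i (n + 1) (by omega)).symm) ha
          have hle : braidAlg g (n + 1) ≤ braidAlg g (n + 1 + 1) :=
            braidAlg_mono g (by omega)
          have hgn : g n ∈ braidAlg g (n + 1 + 1) := mem_braidAlg g (by omega)
          have ha' := ih (by omega) a ha
          clear ha
          induction ha' using Submodule.span_induction with
          | zero => simp
          | add y z _ _ ihy ihz =>
            simp only [add_mul, mul_add]
            exact add_mem ihy ihz
          | smul d y _ ih =>
            simp only [smul_mul_assoc, mul_smul_comm]
            exact Submodule.smul_mem _ _ ih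
          | mem y hy =>
            rcases hy with hy | ⟨a₁, ha₁, a₂, ha₂, rfl⟩
            · have : g (n + 1) * (y * g (n + 1) * b) = y * b + c • (y * g (n + 1) * b) := by
                rw [← mul_assoc, ← mul_assoc, (hcomm y hy).eq, mul_assoc y, hc _ (by omega),
                  mul_add, mul_one, add_mul, mul_smul_comm, smul_mul_assoc]
              rw [this]
              exact add_mem (Submodule.subset_span (Or.inl (mul_mem (hle hy) hb)))
                (Submodule.smul_mem _ _
                  (Submodule.subset_span (Or.inr ⟨y, hle hy, b, hb, rfl⟩)))
            · refine Submodule.subset_span (Or.inr ⟨a₁ * g n, mul_mem (hle ha₁) hgn,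
                g n * a₂ * b, mul_mem (mul_mem hgn (hle ha₂)) hb, ?_⟩)
              calc g (n + 1) * (a₁ * g n * a₂ * g (n + 1) * b)
                  = (g (n + 1) * a₁) * g n * (a₂ * g (n + 1)) * b := by simp only [mul_assoc]
                _ = a₁ * (g (n + 1) * g n * g (n + 1)) * a₂ * b := by
                    rw [(hcomm a₁ ha₁).eq, ← (hcomm a₂ ha₂).eq]; simp only [mul_assoc]
                _ = a₁ * g n * g (n + 1) * (g n * a₂ * b) := by
                    rw [← hg.braid n (by omega)]; simp only [mul_assoc]

end BraidSequences

section PartialTrace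

/-- Operators on `V^{⊗k}` with coefficients in `A`. -/
abbrev TMat (N k : ℕ) (A : Type*) := Matrix (Fin k → Fin N) (Fin k → Fin N) A

variable {A : Type*} [Ring A] [Algebra ℂ A] {N : ℕ}

lemma sum_snoc {β : Type*} [AddCommMonoid β] {k : ℕ} (f : (Fin (k + 1) → Fin N) → β) :
    ∑ c, f c = ∑ c : Fin k → Fin N, ∑ u : Fin N, f (Fin.snoc (α := fun _ => Fin N) c u) := by
  rw [Finset.sum_comm, ← Fintype.sum_prod_type', ← (Fin.snocEquiv fun _ => Fin N).sum_comp]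
  rfl

/-- Extension of an operator by the identity on a new last tensor factor. -/
def extLast {k : ℕ} : TMat N k A →ₐ[ℂ] TMat N (k + 1) A :=
  localizeHom Fin.castSucc (Fin.castSucc_injective k)

lemma extLast_snoc {k : ℕ} (X : TMat N k A) (a b : Fin k → Fin N) (s t : Fin N) :
    extLast X (Fin.snoc (α := fun _ => Fin N) a s) (Fin.snoc (α := fun _ => Fin N) b t) =
      if s = t then X a b else 0 := by
  change localize Fin.castSucc X _ _ = _
  split_ifs with h
  · subst h
    rw [localize_of_eq]
    · congr 1 <;> (funext i; simp)
    · intro l hl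
      obtain rfl : l = Fin.last k := by
        by_contra hne
        exact hl (Fin.exists_castSucc_eq.2 hne)
      simp
  · refine localize_of_ne _ _ fun hc => h ?_
    have := hc (Fin.last k) (by rintro ⟨i, hi⟩; exact (Fin.castSucc_lt_last i).ne hi)
    simpa using this

/-- The weighted partial trace over the last tensor factor. -/
def ptr (C : Matrix (Fin N) (Fin N) ℂ) {k : ℕ} (X : TMat N (k + 1) A) : TMat N k A :=
  Matrix.of fun a b => ∑ s, ∑ t,
    C s t • X (Fin.snoc (α := fun _ => Fin N) a t) (Fin.snoc (α := fun _ => Fin N) b s)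

variable (C : Matrix (Fin N) (Fin N) ℂ)

lemma ptr_add {k : ℕ} (X Y : TMat N (k + 1) A) : ptr C (X + Y) = ptr C X + ptr C Y := by
  ext a b
  simp [ptr, Finset.sum_add_distrib]

lemma ptr_smul {k : ℕ} (c : ℂ) (X : TMat N (k + 1) A) : ptr C (c • X) = c • ptr C X := by
  ext a b
  simp [ptr, Finset.smul_sum, smul_comm c]

lemma ptr_zero {k : ℕ} : ptr C (0 : TMat N (k + 1) A) = 0 := by
  ext a b
  simp [ptr]

lemma extLast_mul_snoc {k : ℕ} (X : TMat N k A) (Y : TMat N (k + 1) A) (a : Fin k → Fin N)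
    (s : Fin N) (d : Fin (k + 1) → Fin N) :
    (extLast X * Y) (Fin.snoc (α := fun _ => Fin N) a s) d =
      ∑ c, X a c * Y (Fin.snoc (α := fun _ => Fin N) c s) d := by
  rw [Matrix.mul_apply, sum_snoc]
  simp [extLast_snoc]

lemma mul_extLast_snoc {k : ℕ} (X : TMat N k A) (Y : TMat N (k + 1) A) (b : Fin k → Fin N)
    (s : Fin N) (d : Fin (k + 1) → Fin N) :
    (Y * extLast X) d (Fin.snoc (α := fun _ => Fin N) b s) =
      ∑ c, Y d (Fin.snoc (α := fun _ => Fin N) c s) * X c b := by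
  rw [Matrix.mul_apply, sum_snoc]
  simp [extLast_snoc]

lemma ptr_extLast_mul {k : ℕ} (X : TMat N k A) (Y : TMat N (k + 1) A) :
    ptr C (extLast X * Y) = X * ptr C Y := by
  ext a b
  simp only [ptr, Matrix.of_apply, extLast_mul_snoc]
  rw [Matrix.mul_apply]
  simp only [Matrix.of_apply, Finset.smul_sum, Finset.mul_sum, mul_smul_comm]
  simp only [Finset.sum_comm (γ := Fin k → Fin N)]

lemma ptr_mul_extLast {k : ℕ} (X : TMat N k A) (Y : TMat N (k + 1) A) :
    ptr C (Y * extLast X) = ptr C Y * X := by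
  ext a b
  simp only [ptr, Matrix.of_apply, mul_extLast_snoc]
  rw [Matrix.mul_apply]
  simp only [Matrix.of_apply, Finset.smul_sum, Finset.sum_mul, smul_mul_assoc]
  simp only [Finset.sum_comm (γ := Fin k → Fin N)]

lemma ptr_one {k : ℕ} : ptr C (1 : TMat N (k + 1) A) = C.trace • (1 : TMat N k A) := by
  rw [← map_one (extLast (A := A) (N := N) (k := k))]
  ext a b
  simp [ptr, extLast_snoc, Matrix.trace, Finset.sum_smul]

lemma extLast_opAt {k i : ℕ} (R : Matrix (Fin N × Fin N) (Fin N × Fin N) A) (h : i + 1 < k) :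
    extLast (opAt N k R i) = opAt N (k + 1) R i :=
  localize_opAt _ (Fin.castSucc_injective k) R h (by omega) rfl rfl

lemma extLast_matAt {k i : ℕ} (X : Matrix (Fin N) (Fin N) A) (h : i < k) :
    extLast (matAt N k X i) = matAt N (k + 1) X i :=
  localize_matAt _ (Fin.castSucc_injective k) X h (by omega) rfl

lemma matAt_last_snoc {k : ℕ} (X : Matrix (Fin N) (Fin N) A) (a b : Fin k → Fin N)
    (s t : Fin N) :
    matAt N (k + 1) X k (Fin.snoc (α := fun _ => Fin N) a s)
      (Fin.snoc (α := fun _ => Fin N) b t) = if a = b then X s t else 0 := by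
  have key : (∀ l : Fin (k + 1), (l : ℕ) ≠ k →
      (Fin.snoc a s : Fin (k + 1) → Fin N) l = (Fin.snoc b t : Fin (k + 1) → Fin N) l) ↔
      a = b := by
    rw [Fin.forall_fin_succ', funext_iff]
    simp only [Fin.snoc_castSucc, Fin.val_castSucc, Fin.val_last, ne_eq, not_true_eq_false,
      false_imp_iff, and_true]
    exact forall_congr' fun i => ⟨fun h => h i.2.ne, fun h _ => h⟩
  have e : (⟨k, by omega⟩ : Fin (k + 1)) = Fin.last k := rfl
  rw [matAt, dif_pos (by omega), Matrix.of_apply, e]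
  simp only [key, Fin.snoc_last]

lemma opAt_last_snoc {k : ℕ} (R : Matrix (Fin N × Fin N) (Fin N × Fin N) A)
    (a b : Fin k → Fin N) (x y s t : Fin N) :
    opAt N (k + 2) R k
      (Fin.snoc (α := fun _ => Fin N) (Fin.snoc (α := fun _ => Fin N) a x) s)
      (Fin.snoc (α := fun _ => Fin N) (Fin.snoc (α := fun _ => Fin N) b y) t) =
      if a = b then R (x, s) (y, t) else 0 := by
  have key : (∀ l : Fin (k + 2), (l : ℕ) ≠ k → (l : ℕ) ≠ k + 1 →
      (Fin.snoc (Fin.snoc a x : Fin (k + 1) → Fin N) s : Fin (k + 2) → Fin N) l =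
        (Fin.snoc (Fin.snoc b y : Fin (k + 1) → Fin N) t : Fin (k + 2) → Fin N) l) ↔
      a = b := by
    rw [Fin.forall_fin_succ', Fin.forall_fin_succ', funext_iff]
    simp only [Fin.snoc_castSucc, Fin.val_castSucc, Fin.val_last, ne_eq, not_true_eq_false,
      false_imp_iff, imp_true_iff, and_true]
    exact forall_congr' fun i => ⟨fun h => h i.2.ne (by omega), fun h _ _ => h⟩
  have e : (⟨k + 1, by omega⟩ : Fin (k + 2)) = Fin.last (k + 1) := rfl
  have e' : (⟨k, by omega⟩ : Fin (k + 2)) = (Fin.last k).castSucc := rfl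
  rw [opAt, dif_pos (by omega), Matrix.of_apply, e, e']
  simp only [key, Fin.snoc_last, Fin.snoc_castSucc]

lemma qTr_succ {k : ℕ} (X : TMat N (k + 1) A) :
    qTr N (k + 1) (toA A C) X = qTr N k (toA A C) (ptr C X) := by
  have h1 : ((List.range k).map (matAt N (k + 1) (toA A C))).prod =
      extLast ((List.range k).map (matAt N k (toA A C))).prod := by
    rw [map_list_prod, List.map_map]
    congr 1
    refine List.map_congr_left fun i hi => ?_
    exact (extLast_matAt _ (List.mem_range.1 hi)).symm
  have h2 : ∀ (a b : Fin k → Fin N) (s t : Fin N),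
      (matAt N (k + 1) (toA A C) k * X) (Fin.snoc (α := fun _ => Fin N) a s)
        (Fin.snoc (α := fun _ => Fin N) b t) =
      ∑ u, C s u • X (Fin.snoc (α := fun _ => Fin N) a u)
        (Fin.snoc (α := fun _ => Fin N) b t) := by
    intro a b s t
    rw [Matrix.mul_apply, sum_snoc]
    simp [matAt_last_snoc, toA, Algebra.smul_def, Finset.sum_ite_irrel]
  simp only [qTr, List.range_succ, List.map_append, List.prod_append, List.map_cons,
    List.map_nil, List.prod_singleton, h1, Matrix.trace, Matrix.diag]
  rw [sum_snoc]
  refine Finset.sum_congr rfl fun a _ => ?_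
  simp only [mul_assoc, extLast_mul_snoc, h2, Matrix.mul_apply (N := ptr C X)]
  rw [Finset.sum_comm]
  refine Finset.sum_congr rfl fun c _ => ?_
  simp [ptr, Finset.mul_sum]

lemma conj_extLast_snoc {k : ℕ} (S T : Matrix (Fin N × Fin N) (Fin N × Fin N) ℂ)
    (X : TMat N (k + 1) A) (a b : Fin k → Fin N) (x y s t : Fin N) :
    (opAt N (k + 2) (toA A S) k * extLast X * opAt N (k + 2) (toA A T) k)
      (Fin.snoc (α := fun _ => Fin N) (Fin.snoc (α := fun _ => Fin N) a x) t)
      (Fin.snoc (α := fun _ => Fin N) (Fin.snoc (α := fun _ => Fin N) b y) s) =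
    ∑ w, ∑ u, (∑ v, S (x, t) (u, v) * T (w, v) (y, s)) •
      X (Fin.snoc (α := fun _ => Fin N) a u) (Fin.snoc (α := fun _ => Fin N) b w) := by
  have h1 : ∀ (d : Fin (k + 1) → Fin N) (v : Fin N),
      (opAt N (k + 2) (toA A S) k * extLast X)
        (Fin.snoc (α := fun _ => Fin N) (Fin.snoc (α := fun _ => Fin N) a x) t)
        (Fin.snoc (α := fun _ => Fin N) d v) =
      ∑ u, S (x, t) (u, v) • X (Fin.snoc (α := fun _ => Fin N) a u) d := by
    intro d v
    rw [mul_extLast_snoc, sum_snoc]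
    simp [opAt_last_snoc, toA, Algebra.smul_def, Finset.sum_ite_irrel]
  rw [Matrix.mul_apply, sum_snoc, sum_snoc]
  simp only [h1, opAt_last_snoc]
  rw [Finset.sum_eq_single b]
  · refine Finset.sum_congr rfl fun w _ => ?_
    simp only [if_true, Finset.sum_mul, Finset.sum_smul]
    rw [Finset.sum_comm]
    refine Finset.sum_congr rfl fun u _ => Finset.sum_congr rfl fun v _ => ?_
    rw [toA, Matrix.map_apply, mul_smul, smul_mul_assoc, ← Algebra.commutes,
      ← Algebra.smul_def]
  · intro c _ hc
    simp [hc]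
  · simp

variable {R Rinv Ψ : Matrix (Fin N × Fin N) (Fin N × Fin N) ℂ}

lemma ptr_opAt_last (hΨ : SkewInv N R Ψ) (k : ℕ) :
    ptr (traceMat N Ψ) (opAt N (k + 2) (toA A R) k) = 1 := by
  have key : ∀ x y : Fin N, ∑ s, ∑ t, traceMat N Ψ s t * R (x, t) (y, s) =
      if x = y then 1 else 0 := by
    intro x y
    have h : ∀ m, ∑ t, ∑ s, R (x, t) (y, s) * Ψ (s, m) (t, m) =
        if x = m ∧ m = y then 1 else 0 := fun m => hΨ.1 x m y m
    have h' := Finset.sum_congr (rfl : (Finset.univ : Finset (Fin N)) = _) fun m _ => h m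
    have h2 : ∑ m, (if x = m ∧ m = y then (1 : ℂ) else 0) = if x = y then 1 else 0 := by
      simp [ite_and]
    rw [h2] at h'
    rw [← h']
    simp only [traceMat, Matrix.of_apply, Finset.sum_mul]
    rw [Finset.sum_comm]
    conv_rhs => rw [Finset.sum_comm]
    refine Finset.sum_congr rfl fun t _ => ?_
    rw [Finset.sum_comm' (t' := Finset.univ) (s' := fun _ => Finset.univ) (by simp)]
    refine Finset.sum_congr rfl fun m _ => Finset.sum_congr rfl fun s _ => mul_comm _ _
  ext a b
  induction a using Fin.snocCases with | snoc a x => ?_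
  induction b using Fin.snocCases with | snoc b y => ?_
  rw [← map_one (extLast (A := A) (N := N) (k := k)), extLast_snoc, Matrix.one_apply]
  simp only [ptr, Matrix.of_apply, opAt_last_snoc]
  by_cases hab : a = b
  · simp only [hab, if_true, toA, Matrix.map_apply, Algebra.smul_def, ← map_mul, ← map_sum,
      key]
    split_ifs <;> simp
  · simp [hab]

lemma sum_comm_pairs {β : Type*} [AddCommMonoid β] (f : Fin N → Fin N → Fin N → Fin N → β) :
    ∑ a, ∑ b, ∑ c, ∑ d, f a b c d = ∑ c, ∑ d, ∑ a, ∑ b, f a b c d := by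
  have : ∑ p : Fin N × Fin N, ∑ r : Fin N × Fin N, f p.1 p.2 r.1 r.2 =
      ∑ r : Fin N × Fin N, ∑ p : Fin N × Fin N, f p.1 p.2 r.1 r.2 := Finset.sum_comm
  simpa only [Fintype.sum_prod_type] using this

/-- The braid relation and skew-invertibility determine the partial trace of `R⁻¹ X₁ R`. -/
lemma sum_traceMat_conj (hRinv : R * Rinv = 1 ∧ Rinv * R = 1) (hbraid : IsBraid N R)
    (hΨ : SkewInv N R Ψ) (x y u w : Fin N) :
    ∑ s, ∑ t, traceMat N Ψ s t * ∑ v, Rinv (x, t) (u, v) * R (w, v) (y, s) =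
      if x = y then traceMat N Ψ w u else 0 := by
  have hinv : ∀ i, opAt N 3 (toA ℂ R) i * opAt N 3 (toA ℂ Rinv) i = 1 := fun i => by
    rw [← opAt_mul, ← toA_mul, hRinv.1, toA_one, opAt_one]
  have hinv' : ∀ i, opAt N 3 (toA ℂ Rinv) i * opAt N 3 (toA ℂ R) i = 1 := fun i => by
    rw [← opAt_mul, ← toA_mul, hRinv.2, toA_one, opAt_one]
  have hb := opAt_braid (A := ℂ) (k := 3) (i := 0) hbraid (by omega)
  have h1 : opAt N 3 (toA ℂ Rinv) 1 * extLast (opAt N 2 (toA ℂ R) 0) * opAt N 3 (toA ℂ R) 1 =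
      extLast (opAt N 2 (toA ℂ R) 0) * opAt N 3 (toA ℂ R) 1 *
        extLast (opAt N 2 (toA ℂ Rinv) 0) := by
    rw [extLast_opAt _ (by omega), extLast_opAt _ (by omega)]
    calc opAt N 3 (toA ℂ Rinv) 1 * opAt N 3 (toA ℂ R) 0 * opAt N 3 (toA ℂ R) 1
        = opAt N 3 (toA ℂ Rinv) 1 * (opAt N 3 (toA ℂ R) 0 * opAt N 3 (toA ℂ R) 1 *
            opAt N 3 (toA ℂ R) 0) * opAt N 3 (toA ℂ Rinv) 0 := by
          simp only [mul_assoc, hinv, mul_one]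
      _ = opAt N 3 (toA ℂ R) 0 * opAt N 3 (toA ℂ R) 1 * opAt N 3 (toA ℂ Rinv) 0 := by
          rw [hb]
          simp only [← mul_assoc, zero_add, hinv', one_mul]
  have h2 : ptr (traceMat N Ψ) (opAt N 3 (toA ℂ Rinv) 1 * extLast (opAt N 2 (toA ℂ R) 0) *
      opAt N 3 (toA ℂ R) 1) = 1 := by
    rw [h1, ptr_mul_extLast, ptr_extLast_mul, ptr_opAt_last hΨ 1, mul_one, ← opAt_mul,
      ← toA_mul, hRinv.1, toA_one, opAt_one]
  set G : Fin N → Fin N → ℂ := fun u w =>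
    ∑ s, ∑ t, traceMat N Ψ s t * ∑ v, Rinv (x, t) (u, v) * R (w, v) (y, s) with hG
  have h3 : ∀ c d : Fin N, ∑ w, ∑ u, G u w * R (c, u) (d, w) =
      if x = y then (if c = d then 1 else 0) else 0 := by
    intro c d
    have h4 := congrFun (congrFun h2
      (Fin.snoc (α := fun _ => Fin N) (Fin.snoc (α := fun _ => Fin N) default c) x))
      (Fin.snoc (α := fun _ => Fin N) (Fin.snoc (α := fun _ => Fin N) default d) y)
    rw [← map_one (extLast (A := ℂ) (N := N) (k := 1)), extLast_snoc,
      ← map_one (extLast (A := ℂ) (N := N) (k := 0)), extLast_snoc, Matrix.one_apply] at h4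
    simp only [if_true] at h4
    rw [← h4]
    simp only [ptr, Matrix.of_apply, conj_extLast_snoc, opAt_last_snoc, if_true]
    simp only [toA, Matrix.map_apply, Algebra.algebraMap_self, RingHom.id_apply, smul_eq_mul]
    simp only [hG, Finset.sum_mul, Finset.mul_sum]
    rw [sum_comm_pairs]
    simp only [mul_assoc]
  have h5 : ∀ w' u' : Fin N, ∑ d, ∑ c, Ψ (w, d) (u, c) * R (c, u') (d, w') =
      if w = w' ∧ u' = u then 1 else 0 := fun w' u' => hΨ.2 w u' u w'
  change G u w = _
  calc G u w = ∑ w', ∑ u', G u' w' * if w = w' ∧ u' = u then 1 else 0 := by simp [ite_and]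
    _ = ∑ d, ∑ c, Ψ (w, d) (u, c) * ∑ w', ∑ u', G u' w' * R (c, u') (d, w') := by
        simp only [← h5, Finset.mul_sum]
        rw [sum_comm_pairs]
        refine Finset.sum_congr rfl fun _ _ => Finset.sum_congr rfl fun _ _ =>
          Finset.sum_congr rfl fun _ _ => Finset.sum_congr rfl fun _ _ => ?_
        ring
    _ = if x = y then traceMat N Ψ w u else 0 := by
        simp only [h3]
        split_ifs <;> simp [traceMat]

/-- The weighted partial trace of `R⁻¹ X R`, with `R` acting on the last two factors and `X` on
all but the last one. -/
lemma ptr_conj_extLast (hRinv : R * Rinv = 1 ∧ Rinv * R = 1) (hbraid : IsBraid N R)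
    (hΨ : SkewInv N R Ψ) {k : ℕ} (X : TMat N (k + 1) A) :
    ptr (traceMat N Ψ) (opAt N (k + 2) (toA A Rinv) k * extLast X *
      opAt N (k + 2) (toA A R) k) = extLast (ptr (traceMat N Ψ) X) := by
  ext a b
  induction a using Fin.snocCases with | snoc a x => ?_
  induction b using Fin.snocCases with | snoc b y => ?_
  rw [extLast_snoc]
  simp only [ptr, Matrix.of_apply, conj_extLast_snoc, Finset.smul_sum, smul_smul]
  rw [sum_comm_pairs]
  simp only [← Finset.sum_smul, sum_traceMat_conj hRinv hbraid hΨ]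
  split_ifs <;> simp

end PartialTrace

section IteratedTrace

variable {A : Type*} [Ring A] {N : ℕ}

lemma qTr_zero_sites (C : Matrix (Fin N) (Fin N) A) (X : TMat N 0 A) :
    Matrix.diagonal (fun _ => qTr N 0 C X) = X := by
  ext a b
  obtain rfl : a = b := Subsingleton.elim a b
  simp [qTr, Matrix.trace, Subsingleton.elim a default]

variable [Algebra ℂ A]

/-- `IsPtrOf C Y X` says that `Y` arises from `X` by iterated partial traces over last factors. -/
inductive IsPtrOf (C : Matrix (Fin N) (Fin N) ℂ) {n : ℕ} (Y : TMat N n A) :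
    ∀ {k : ℕ}, TMat N k A → Prop
  | refl : IsPtrOf C Y Y
  | step {k : ℕ} (X : TMat N (k + 1) A) : IsPtrOf C Y (ptr C X) → IsPtrOf C Y X

lemma commute_diagonal_toA {ι : Type*} [Fintype ι] [DecidableEq ι] (s : A)
    (X : Matrix ι ι ℂ) : Commute (Matrix.diagonal fun _ => s) (toA A X) := by
  rw [Commute, SemiconjBy]
  ext a b
  rw [Matrix.diagonal_mul, Matrix.mul_diagonal]
  exact (Algebra.commutes _ _).symm

lemma matAt_toA (k i : ℕ) (X : Matrix (Fin N) (Fin N) ℂ) :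
    matAt N k (toA A X) i = toA A (matAt N k X i) := by
  by_cases h : i < k
  · ext a b
    simp only [matAt, h, dite_true, toA, Matrix.of_apply, Matrix.map_apply]
    split_ifs <;> simp
  · rw [matAt, matAt, dif_neg h, dif_neg h, toA_one]

lemma qTr_diagonal_mul (C : Matrix (Fin N) (Fin N) ℂ) {k : ℕ} (s : A) (X : TMat N k A) :
    qTr N k (toA A C) (Matrix.diagonal (fun _ => s) * X) = s * qTr N k (toA A C) X := by
  have h : Commute (Matrix.diagonal fun _ => s)
      ((List.range k).map (matAt N k (toA A C))).prod := by
    refine Commute.list_prod_right _ _ fun y hy => ?_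
    obtain ⟨i, _, rfl⟩ := List.mem_map.1 hy
    rw [matAt_toA]
    exact commute_diagonal_toA s _
  rw [qTr, ← mul_assoc, ← h.eq, mul_assoc, qTr]
  simp [Matrix.trace, Finset.mul_sum]

namespace IsPtrOf

variable {C : Matrix (Fin N) (Fin N) ℂ} {n k : ℕ} {Y : TMat N n A} {X : TMat N k A}

lemma qTr_eq (hXY : IsPtrOf C Y X) : qTr N k (toA A C) X = qTr N n (toA A C) Y := by
  induction hXY with
  | refl => rfl
  | step X _ ih => rw [qTr_succ, ih]

lemma le (hXY : IsPtrOf C Y X) : n ≤ k := by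
  induction hXY with
  | refl => exact le_rfl
  | step X _ ih => omega

lemma mul_localize (hXY : IsPtrOf C Y X) (W : TMat N n A) (hnk : n ≤ k) :
    IsPtrOf C (Y * W) (X * localize (Fin.castLE hnk) W) := by
  induction hXY with
  | refl =>
    have : localize (Fin.castLE hnk) W = W := by
      ext a b
      rw [localize_of_eq]
      · rfl
      · exact fun l hl => absurd ⟨l, rfl⟩ hl
    rw [this]
    exact refl
  | step X h ih =>
    refine step _ ?_
    have h1 : localize (Fin.castLE hnk) W = extLast (localize (Fin.castLE h.le) W) :=
      (localize_localize Fin.castSucc (Fin.castLE h.le) (Fin.castSucc_injective _) W).symm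
    rw [h1, ptr_mul_extLast]
    exact ih h.le

lemma diagonal_qTr (C : Matrix (Fin N) (Fin N) ℂ) {k : ℕ} (X : TMat N k A) :
    IsPtrOf C (Matrix.diagonal (fun _ => qTr N k (toA A C) X) : TMat N 0 A) X := by
  induction k with
  | zero =>
    rw [qTr_zero_sites]
    exact refl
  | succ k ih =>
    refine step _ ?_
    rw [qTr_succ]
    exact ih _

end IsPtrOf

variable {R Rinv Ψ : Matrix (Fin N × Fin N) (Fin N × Fin N) ℂ}

lemma isBraidSeq_opAt (hRinv : R * Rinv = 1 ∧ Rinv * R = 1) (hbraid : IsBraid N R) (k : ℕ) :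
    IsBraidSeq k (opAt N k (toA A R)) (opAt N k (toA A Rinv)) where
  mul_inv i := by rw [← opAt_mul, ← toA_mul, hRinv.1, toA_one, opAt_one]
  inv_mul i := by rw [← opAt_mul, ← toA_mul, hRinv.2, toA_one, opAt_one]
  far i j hij := opAt_commute_opAt k R R hij
  braid i hi := opAt_braid hbraid hi

lemma extLast_descProd {k : ℕ} (S : Matrix (Fin N × Fin N) (Fin N × Fin N) A) (m : ℕ)
    (hm : m < k) :
    extLast (descProd (opAt N k S) m) = descProd (opAt N (k + 1) S) m := by
  induction m with
  | zero => exact map_one _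
  | succ m ih => rw [descProd, map_mul, ih (by omega), extLast_opAt _ hm, descProd]

lemma extLast_ascProd {k : ℕ} (S : Matrix (Fin N × Fin N) (Fin N × Fin N) A) (m : ℕ)
    (hm : m < k) :
    extLast (ascProd (opAt N k S) m) = ascProd (opAt N (k + 1) S) m := by
  induction m with
  | zero => exact map_one _
  | succ m ih => rw [ascProd, map_mul, ih (by omega), extLast_opAt _ hm, ascProd]

lemma extLast_unSeq {k : ℕ} (S T : Matrix (Fin N × Fin N) (Fin N × Fin N) A)
    (X : Matrix (Fin N) (Fin N) A) (r : ℕ) (hr : r < k) :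
    extLast (unSeq (opAt N k S) (opAt N k T) (matAt N k X 0) r) =
      unSeq (opAt N (k + 1) S) (opAt N (k + 1) T) (matAt N (k + 1) X 0) r := by
  induction r with
  | zero => exact extLast_matAt X hr
  | succ r ih =>
    rw [unSeq, map_mul, map_mul, ih (by omega), extLast_opAt _ hr, extLast_opAt _ hr, unSeq]

lemma map_extLast_braidAlg {k n : ℕ} (S : Matrix (Fin N × Fin N) (Fin N × Fin N) A)
    (h : n ≤ k) :
    (braidAlg (opAt N k S) n).map extLast = braidAlg (opAt N (k + 1) S) n := by
  rw [braidAlg, AlgHom.map_adjoin, braidAlg]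
  congr 1
  ext x
  constructor
  · rintro ⟨_, ⟨i, hi, rfl⟩, rfl⟩
    exact ⟨i, hi, extLast_opAt _ (by omega)⟩
  · rintro ⟨i, hi, rfl⟩
    exact ⟨_, ⟨i, hi, rfl⟩, extLast_opAt _ (by omega)⟩

lemma IsPtrOf.conj_extLast (hRinv : R * Rinv = 1 ∧ Rinv * R = 1) (hbraid : IsBraid N R)
    (hΨ : SkewInv N R Ψ) {n k : ℕ} {Y : TMat N n A} {X : TMat N k A}
    (hXY : IsPtrOf (traceMat N Ψ) Y X) :
    IsPtrOf (traceMat N Ψ)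
      (ascProd (opAt N (n + 1) (toA A Rinv)) n * extLast Y *
        descProd (opAt N (n + 1) (toA A R)) n)
      (ascProd (opAt N (k + 1) (toA A Rinv)) k * extLast X *
        descProd (opAt N (k + 1) (toA A R)) k) := by
  induction hXY with
  | refl => exact refl
  | @step k X _ ih =>
    refine step _ ?_
    have : ascProd (opAt N (k + 1 + 1) (toA A Rinv)) (k + 1) * extLast X *
        descProd (opAt N (k + 1 + 1) (toA A R)) (k + 1) =
        extLast (ascProd (opAt N (k + 1) (toA A Rinv)) k) *
          (opAt N (k + 2) (toA A Rinv) k * extLast X * opAt N (k + 2) (toA A R) k) *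
          extLast (descProd (opAt N (k + 1) (toA A R)) k) := by
      rw [extLast_ascProd _ _ (by omega), extLast_descProd _ _ (by omega), ascProd, descProd]
      simp only [mul_assoc]
    rw [this, ptr_mul_extLast, ptr_extLast_mul, ptr_conj_extLast hRinv hbraid hΨ]
    exact ih

lemma eq_inv_add_of_isHecke {q : ℂ} (hq : q ≠ 0) (hRinv : R * Rinv = 1 ∧ Rinv * R = 1)
    (hHecke : IsHecke N q R) : R = Rinv + (q - q⁻¹) • 1 := by
  have h : R * R = 1 + (q - q⁻¹) • R := by
    have h := hHecke
    rw [IsHecke, sub_mul, smul_mul_assoc, one_mul, smul_add, smul_smul, mul_inv_cancel₀ hq,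
      one_smul, mul_add, mul_smul_comm, mul_one, sub_eq_zero] at h
    rw [sub_smul, ← add_sub_assoc]
    exact eq_sub_of_add_eq' h.symm
  have h' := congrArg (· * Rinv) h
  simpa only [mul_assoc, hRinv.1, mul_one, add_mul, one_mul, smul_mul_assoc] using h'

lemma toA_smul_one {ι : Type*} [DecidableEq ι] (c : ℂ) :
    toA A (c • (1 : Matrix ι ι ℂ)) = c • 1 := by
  ext a b
  rw [toA, Matrix.map_apply, Matrix.smul_apply, Matrix.smul_apply, Matrix.one_apply,
    Matrix.one_apply, smul_eq_mul, map_mul, Algebra.smul_def]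
  split_ifs <;> simp

lemma opAt_eq_inv_add {q : ℂ} (hq : q ≠ 0) (hRinv : R * Rinv = 1 ∧ Rinv * R = 1)
    (hHecke : IsHecke N q R) {k i : ℕ} (hi : i + 1 < k) :
    opAt N k (toA A R) i = opAt N k (toA A Rinv) i + (q - q⁻¹) • 1 := by
  have h : toA A R = toA A Rinv + toA A ((q - q⁻¹) • 1) := by
    rw [toA, eq_inv_add_of_isHecke hq hRinv hHecke]
    exact Matrix.map_add _ (map_add _) _ _
  rw [h, opAt_add hi]
  congr 1
  rw [opAt_toA]
  have h2 : opAt N k ((q - q⁻¹) • (1 : Matrix (Fin N × Fin N) (Fin N × Fin N) ℂ)) i =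
      (q - q⁻¹) • 1 := by
    rw [← opAt_one k i]
    ext a b
    simp only [opAt, hi, dite_true, Matrix.of_apply, Matrix.smul_apply]
    split_ifs <;> simp
  rw [h2, toA_smul_one]

lemma inv_mem_braidAlg {q : ℂ} (hq : q ≠ 0) (hRinv : R * Rinv = 1 ∧ Rinv * R = 1)
    (hHecke : IsHecke N q R) {k n i : ℕ} (hi : i + 1 < n) (hn : n ≤ k) :
    opAt N k (toA A Rinv) i ∈ braidAlg (opAt N k (toA A R)) n := by
  have h := opAt_eq_inv_add (A := A) hq hRinv hHecke (k := k) (i := i) (by omega)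
  rw [eq_sub_of_add_eq h.symm]
  exact sub_mem (mem_braidAlg _ hi) (Subalgebra.smul_mem _ (one_mem _) _)

/-- The partial trace maps the Hecke algebra image on `n + 2` factors to that on `n + 1`. -/
lemma ptr_mem_braidAlg {q : ℂ} (hq : q ≠ 0) (hRinv : R * Rinv = 1 ∧ Rinv * R = 1)
    (hbraid : IsBraid N R) (hHecke : IsHecke N q R) (hΨ : SkewInv N R Ψ) {n : ℕ}
    {X : TMat N (n + 2) A} (hX : X ∈ braidAlg (opAt N (n + 2) (toA A R)) (n + 2)) :
    ptr (traceMat N Ψ) X ∈ braidAlg (opAt N (n + 1) (toA A R)) (n + 1) := by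
  have hg := isBraidSeq_opAt (A := A) hRinv hbraid (n + 2)
  have hsq : ∀ i, i + 1 < n + 2 → opAt N (n + 2) (toA A R) i * opAt N (n + 2) (toA A R) i =
      1 + (q - q⁻¹) • opAt N (n + 2) (toA A R) i := by
    intro i hi
    conv_lhs => rw [opAt_eq_inv_add hq hRinv hHecke hi]
    rw [← opAt_eq_inv_add hq hRinv hHecke hi]
    conv_lhs =>
      arg 1
      rw [opAt_eq_inv_add hq hRinv hHecke hi]
    rw [add_mul, hg.inv_mul, smul_mul_assoc, one_mul]
  have h := hg.mem_span_of_mem_braidAlg (q - q⁻¹) hsq n (by omega) X hX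
  rw [← map_extLast_braidAlg _ le_rfl] at h
  clear hX
  induction h using Submodule.span_induction with
  | zero => rw [ptr_zero]; exact zero_mem _
  | add Y Z _ _ ihY ihZ => rw [ptr_add]; exact add_mem ihY ihZ
  | smul c Y _ ih => rw [ptr_smul]; exact Subalgebra.smul_mem _ ih _
  | mem Y hY =>
    rcases hY with ⟨Y, hY, rfl⟩ | ⟨_, ⟨a, ha, rfl⟩, _, ⟨b, hb, rfl⟩, rfl⟩
    · have := ptr_extLast_mul (traceMat N Ψ) Y 1
      rw [mul_one, ptr_one, mul_smul_comm, mul_one] at this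
      change ptr _ (extLast Y) ∈ _
      rw [this]
      exact Subalgebra.smul_mem _ hY _
    · change ptr _ (extLast a * _ * extLast b) ∈ _
      rw [ptr_mul_extLast, ptr_extLast_mul, ptr_opAt_last hΨ, mul_one]
      exact mul_mem ha hb

lemma exists_isPtrOf_mem_braidAlg {q : ℂ} (hq : q ≠ 0)
    (hRinv : R * Rinv = 1 ∧ Rinv * R = 1) (hbraid : IsBraid N R) (hHecke : IsHecke N q R)
    (hΨ : SkewInv N R Ψ) {n k : ℕ} (hn : 1 ≤ n) (hnk : n ≤ k) :
    ∀ X ∈ braidAlg (opAt N k (toA A R)) k, ∃ Y ∈ braidAlg (opAt N n (toA A R)) n,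
      IsPtrOf (traceMat N Ψ) Y X := by
  induction k, hnk using Nat.le_induction with
  | base => exact fun X hX => ⟨X, hX, .refl⟩
  | succ k hk ih =>
    intro X hX
    obtain ⟨k, rfl⟩ : ∃ k', k = k' + 1 := ⟨k - 1, by omega⟩
    obtain ⟨Y, hY, h⟩ := ih _ (ptr_mem_braidAlg hq hRinv hbraid hHecke hΨ hX)
    exact ⟨Y, hY, .step _ h⟩

lemma ascProd_mem_braidAlg {q : ℂ} (hq : q ≠ 0) (hRinv : R * Rinv = 1 ∧ Rinv * R = 1)
    (hHecke : IsHecke N q R) {k : ℕ} (m : ℕ) (hm : m < k) :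
    ascProd (opAt N k (toA A Rinv)) m ∈ braidAlg (opAt N k (toA A R)) k := by
  induction m with
  | zero => exact one_mem _
  | succ m ih =>
    exact mul_mem (ih (by omega)) (inv_mem_braidAlg hq hRinv hHecke hm le_rfl)

lemma descProd_mem_braidAlg {k : ℕ} (m : ℕ) (hm : m < k) :
    descProd (opAt N k (toA A R)) m ∈ braidAlg (opAt N k (toA A R)) k := by
  induction m with
  | zero => exact one_mem _
  | succ m ih => exact mul_mem (mem_braidAlg _ hm) (ih (by omega))

lemma semiconj_list_prod {B : Type*} [Ring B] {u : B} (f f' : ℕ → B) (l : List ℕ)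
    (h : ∀ i ∈ l, SemiconjBy u (f' i) (f i)) :
    SemiconjBy u (l.map f').prod (l.map f).prod := by
  induction l with
  | nil => exact SemiconjBy.one_right u
  | cons i l ih =>
    rw [List.map_cons, List.map_cons, List.prod_cons, List.prod_cons]
    exact (h i (by simp)).mul_right (ih fun j hj => h j (by simp [hj]))

/-- The quantum trace of `Q X_{[p]} ⋯ X_{[1]}` as a partial trace of a product of the copies of
`X` with labels shifted by `n`. -/
lemma exists_isPtrOf_shift {q : ℂ} (hq : q ≠ 0) (hRinv : R * Rinv = 1 ∧ Rinv * R = 1)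
    (hbraid : IsBraid N R) (hHecke : IsHecke N q R) (hΨ : SkewInv N R Ψ)
    (X : Matrix (Fin N) (Fin N) A) (p : ℕ) (Q : TMat N p A)
    (hQ : Q ∈ braidAlg (opAt N p (toA A R)) p) (n : ℕ) :
    ∃ k, k = n + p ∧ ∃ Q' ∈ braidAlg (opAt N k (toA A R)) k,
      IsPtrOf (traceMat N Ψ)
        (Matrix.diagonal fun _ => qTr N p (toA A (traceMat N Ψ))
          (Q * ((List.range p).reverse.map (unSeq (opAt N p (toA A R))
            (opAt N p (toA A Rinv)) (matAt N p X 0))).prod) : TMat N n A)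
        (Q' * ((List.range p).reverse.map fun i => unSeq (opAt N k (toA A R))
            (opAt N k (toA A Rinv)) (matAt N k X 0) (n + i)).prod) := by
  generalize hs : qTr N p (toA A (traceMat N Ψ)) _ = s
  induction n with
  | zero =>
    refine ⟨p, by omega, Q, hQ, ?_⟩
    simp only [zero_add, ← hs]
    exact IsPtrOf.diagonal_qTr _ _
  | succ n ih =>
    obtain ⟨k, hk, Q', hQ', h⟩ := ih
    have hg := isBraidSeq_opAt (A := A) hRinv hbraid (k + 1)
    have hx : ∀ j, 1 ≤ j → Commute (matAt N (k + 1) X 0) (opAt N (k + 1) (toA A R) j) :=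
      fun j hj => matAt_commute_opAt _ _ _ hj
    refine ⟨k + 1, by omega, ascProd (opAt N (k + 1) (toA A Rinv)) k * extLast Q' *
        descProd (opAt N (k + 1) (toA A R)) k, ?_, ?_⟩
    · refine mul_mem (mul_mem (ascProd_mem_braidAlg hq hRinv hHecke k (by omega))
        (braidAlg_mono _ (Nat.le_succ k) ?_)) (descProd_mem_braidAlg k (by omega))
      rw [← map_extLast_braidAlg _ le_rfl]
      exact ⟨Q', hQ', rfl⟩
    · have h' := h.conj_extLast hRinv hbraid hΨ
      have e1 : ascProd (opAt N (n + 1) (toA A Rinv)) n *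
          extLast (Matrix.diagonal (fun _ => s) : TMat N n A) *
          descProd (opAt N (n + 1) (toA A R)) n = Matrix.diagonal fun _ => s := by
        have hd : extLast (Matrix.diagonal (fun _ => s) : TMat N n A) =
            Matrix.diagonal fun _ => s := localize_diagonal _ s
        have hc : ∀ m, Commute (Matrix.diagonal fun _ => s : TMat N (n + 1) A)
            (descProd (opAt N (n + 1) (toA A R)) m) := by
          intro m
          induction m with
          | zero => exact Commute.one_right _
          | succ m ih =>
            refine Commute.mul_right ?_ ih
            rw [opAt_toA]
            exact commute_diagonal_toA s _
        rw [hd, mul_assoc, (hc n).eq, ← mul_assoc,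
          (isBraidSeq_opAt hRinv hbraid (n + 1)).ascProd_mul_descProd, one_mul]
      rw [e1, map_mul, map_list_prod, List.map_map] at h'
      have e2 := semiconj_list_prod (u := descProd (opAt N (k + 1) (toA A R)) k)
        (extLast ∘ fun i => unSeq (opAt N k (toA A R)) (opAt N k (toA A Rinv))
          (matAt N k X 0) (n + i))
        (fun i => unSeq (opAt N (k + 1) (toA A R)) (opAt N (k + 1) (toA A Rinv))
          (matAt N (k + 1) X 0) (n + 1 + i)) (List.range p).reverse (by
            intro i hi
            have hi : i < p := by simpa using hi
            rw [Function.comp_apply, extLast_unSeq _ _ _ _ (by omega), add_right_comm]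
            exact (hg.unSeq_mul_descProd hx k (by omega) (n + i) (by omega)).symm)
      convert h' using 1
      rw [mul_assoc, e2.eq]
      simp only [mul_assoc]

end IteratedTrace

section ActionOnMonomials

lemma palProd_mem_braidAlg {B : Type*} [Ring B] [Algebra ℂ B] {k : ℕ} {g h : ℕ → B}
    (hinv : ∀ i, i + 1 < k → h i ∈ braidAlg g (i + 2)) (n : ℕ) (hn : n < k) :
    palProd h n ∈ braidAlg g (n + 1) := by
  induction n with
  | zero => exact one_mem _
  | succ n ih =>
    have hh := hinv n hn
    exact mul_mem (mul_mem hh (braidAlg_mono _ (by omega) (ih (by omega)))) hh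

namespace IsBraidSeq

variable {B : Type*} [Ring B] {k : ℕ} {g h : ℕ → B} (hg : IsBraidSeq k g h) (J : Ideal B)

include hg

lemma ovSeq_sub_one_mem (hJ : ∀ i, ∀ z ∈ J, z * h i ∈ J) {x : B} (hx : x - 1 ∈ J) (r : ℕ) :
    ovSeq g h x r - 1 ∈ J := by
  induction r with
  | zero => exact hx
  | succ r ih =>
    have : ovSeq g h x (r + 1) - 1 = g r * ((ovSeq g h x r - 1) * h r) := by
      rw [ovSeq, sub_mul, mul_sub, one_mul, hg.mul_inv, mul_assoc]
    rw [this]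
    exact J.mul_mem_left _ (hJ _ _ ih)

/-- For `x = 1 - c m d` the relations of the quantum double give the exchange relation between
`x` and `m`. -/
lemma exchange_of_double [Algebra ℂ B] {m d : B} {c : ℂ} (hc : g 0 = h 0 + c • 1)
    (hm : g 0 * m * g 0 * m = m * g 0 * m * g 0)
    (hdm : d * g 0 * m * g 0 = g 0 * m * h 0 * d + g 0) :
    (1 - c • (m * d)) * g 0 * m * g 0 = h 0 * m * g 0 * (1 - c • (m * d)) := by
  have e1 : m * g 0 * m * h 0 = h 0 * m * g 0 * m := by
    calc m * g 0 * m * h 0 = h 0 * (g 0 * m * g 0 * m) * h 0 := by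
          simp only [← mul_assoc, hg.inv_mul, one_mul]
      _ = h 0 * m * g 0 * m := by
          rw [hm]; simp only [mul_assoc, hg.mul_inv, mul_one]
  have e2 : m * d * g 0 * m * g 0 = h 0 * m * g 0 * m * d + m * g 0 := by
    calc m * d * g 0 * m * g 0 = m * (d * g 0 * m * g 0) := by simp only [mul_assoc]
      _ = m * g 0 * m * h 0 * d + m * g 0 := by rw [hdm, mul_add]; simp only [mul_assoc]
      _ = _ := by rw [e1]
  have e3 : g 0 * m * g 0 = h 0 * m * g 0 + c • (m * g 0) := by
    calc g 0 * m * g 0 = (h 0 + c • 1) * (m * g 0) := by rw [← hc, mul_assoc]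
      _ = _ := by rw [add_mul, smul_mul_assoc, one_mul, mul_assoc]
  simp only [sub_mul, mul_sub, one_mul, mul_one, smul_mul_assoc, mul_smul_comm]
  rw [e2, e3, smul_add, ← mul_assoc, add_sub_add_right_eq_sub]

variable [Algebra ℂ B] (hinv : ∀ i, i + 1 < k → h i ∈ braidAlg g (i + 2)) {x y : B} (hx : ∀ j, 1 ≤ j → Commute x (g j)) (hy : ∀ j, 1 ≤ j → Commute y (g j))
  (hxy : 1 < k → x * g 0 * y * g 0 = h 0 * y * g 0 * x) (hJg : ∀ i, ∀ z ∈ J, z * g i ∈ J)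
  (hJh : ∀ i, ∀ z ∈ J, z * h i ∈ J) (hx1 : x - 1 ∈ J)

include hinv hx hy hxy hJg hJh hx1

lemma exists_unSeq_mul_sub_mem (n r : ℕ) (hr : n + r < k) :
    ∃ Y ∈ braidAlg g (n + r + 1),
      unSeq g h x (n + r) * ovSeqProd g h y n - Y * ovSeqProd g h y n ∈ J := by
  induction r with
  | zero =>
    refine ⟨palProd h n, palProd_mem_braidAlg hinv n (by omega), ?_⟩
    rw [add_zero, hg.unSeq_mul_ovSeqProd hx hy hxy n (by omega), ← mul_sub_one]
    exact J.mul_mem_left _ (hg.ovSeq_sub_one_mem J hJh hx1 n)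
  | succ r ih =>
    obtain ⟨Y, hY, hmem⟩ := ih (by omega)
    have hY' : Y ∈ braidAlg g (n + (r + 1) + 1) := braidAlg_mono _ (by omega) hY
    refine ⟨h (n + r) * Y * g (n + r),
      mul_mem (mul_mem (hinv (n + r) hr) hY') (mem_braidAlg g (by omega)), ?_⟩
    have hc := (hg.commute_ovSeqProd hy n (n + r) (by omega)).eq
    have : unSeq g h x (n + (r + 1)) * ovSeqProd g h y n -
        h (n + r) * Y * g (n + r) * ovSeqProd g h y n =
        h (n + r) * ((unSeq g h x (n + r) * ovSeqProd g h y n - Y * ovSeqProd g h y n) *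
          g (n + r)) := by
      rw [← add_assoc, unSeq, sub_mul, mul_sub]
      simp only [mul_assoc, hc]
    rw [this]
    exact J.mul_mem_left _ (hJg _ _ hmem)

lemma exists_prod_unSeq_mul_sub_mem (n r : ℕ) (hr : n + r ≤ k) (W : B)
    (hW : W ∈ braidAlg g n) :
    ∃ Y ∈ braidAlg g (n + r),
      ((List.range r).reverse.map fun i => unSeq g h x (n + i)).prod *
        (W * ovSeqProd g h y n) - Y * ovSeqProd g h y n ∈ J := by
  induction r with
  | zero => exact ⟨W, hW, by simp⟩
  | succ r ih =>
    obtain ⟨Y, hY, hmem⟩ := ih (by omega)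
    obtain ⟨Y', hY', hmem'⟩ :=
      hg.exists_unSeq_mul_sub_mem J hinv hx hy hxy hJg hJh hx1 n r (by omega)
    refine ⟨Y * Y', mul_mem (braidAlg_mono _ (by omega) hY) hY', ?_⟩
    have hc : Commute (unSeq g h x (n + r)) Y :=
      commute_of_mem_braidAlg (hg.commute_unSeq_of_lt hx (n + r) (by omega)) hY
    rw [List.range_succ, List.reverse_append, List.reverse_singleton, List.singleton_append,
      List.map_cons, List.prod_cons]
    have e : ∀ S P : B, unSeq g h x (n + r) * S * (W * P) - Y * Y' * P =
        unSeq g h x (n + r) * (S * (W * P) - Y * P) +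
          Y * (unSeq g h x (n + r) * P - Y' * P) := by
      intro S P
      rw [mul_sub, mul_sub, ← mul_assoc _ Y P, hc.eq]
      simp only [mul_assoc]
      abel
    rw [e]
    exact J.add_mem (J.mul_mem_left _ hmem) (J.mul_mem_left _ hmem')

end IsBraidSeq

variable {A : Type*} [Ring A] {N : ℕ}

lemma matAt_mem_matrix (I : Ideal A) {k i : ℕ} (hi : i < k) {X : Matrix (Fin N) (Fin N) A}
    (hX : ∀ a b, X a b ∈ I) : matAt N k X i ∈ I.matrix (Fin k → Fin N) := by
  intro a b
  simp only [matAt, hi, dite_true, Matrix.of_apply]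
  split_ifs
  · exact hX _ _
  · exact I.zero_mem

lemma qTr_mem (I : Ideal A) {k : ℕ} (C : Matrix (Fin N) (Fin N) A) {X : TMat N k A}
    (hX : X ∈ I.matrix (Fin k → Fin N)) : qTr N k C X ∈ I :=
  sum_mem fun a _ => (I.matrix _).mul_mem_left _ hX a a

lemma qTr_sub {k : ℕ} (C : Matrix (Fin N) (Fin N) A) (X Y : TMat N k A) :
    qTr N k C (X - Y) = qTr N k C X - qTr N k C Y := by
  rw [qTr, mul_sub, Matrix.trace_sub, qTr, qTr]

lemma ovCopy_eq_ovSeq {k : ℕ} (R Rinv : Matrix (Fin N × Fin N) (Fin N × Fin N) A)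
    (X : Matrix (Fin N) (Fin N) A) (r : ℕ) :
    ovCopy N k R Rinv X r = ovSeq (opAt N k R) (opAt N k Rinv) (matAt N k X 0) r := by
  induction r with
  | zero => rfl
  | succ r ih => rw [ovCopy, ih, ovSeq]

lemma unCopy_eq_unSeq {k : ℕ} (R Rinv : Matrix (Fin N × Fin N) (Fin N × Fin N) A)
    (X : Matrix (Fin N) (Fin N) A) :
    unCopy N k R Rinv X = unSeq (opAt N k R) (opAt N k Rinv) (matAt N k X 0) := by
  funext r
  induction r with
  | zero => rfl
  | succ r ih => rw [unCopy, ih, unSeq]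

lemma ovProd_eq_ovSeqProd {k : ℕ} (R Rinv : Matrix (Fin N × Fin N) (Fin N × Fin N) A)
    (X : Matrix (Fin N) (Fin N) A) (n : ℕ) :
    ovProd N k R Rinv X n = ovSeqProd (opAt N k R) (opAt N k Rinv) (matAt N k X 0) n := by
  rw [ovProd, ovSeqProd, funext (ovCopy_eq_ovSeq R Rinv X)]

lemma localize_castLE_ovSeq {n k : ℕ} (hnk : n ≤ k)
    (R Rinv : Matrix (Fin N × Fin N) (Fin N × Fin N) A) (X : Matrix (Fin N) (Fin N) A)
    (r : ℕ) (hr : r < n) :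
    localize (Fin.castLE hnk) (ovSeq (opAt N n R) (opAt N n Rinv) (matAt N n X 0) r) =
      ovSeq (opAt N k R) (opAt N k Rinv) (matAt N k X 0) r := by
  have he := Fin.castLE_injective hnk
  induction r with
  | zero => exact localize_matAt _ he _ hr (by omega) rfl
  | succ r ih =>
    rw [ovSeq, localize_mul he, localize_mul he, ih (by omega),
      localize_opAt _ he _ hr (by omega) rfl rfl, localize_opAt _ he _ hr (by omega) rfl rfl,
      ovSeq]

lemma RErel.lift {S : Matrix (Fin N × Fin N) (Fin N × Fin N) A} {M : Matrix (Fin N) (Fin N) A}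
    (hM : RErel N S M) {k : ℕ}
    (hk : 1 < k) :
    opAt N k S 0 * matAt N k M 0 * opAt N k S 0 * matAt N k M 0 =
      matAt N k M 0 * opAt N k S 0 * matAt N k M 0 * opAt N k S 0 := by
  have he := Fin.castLE_injective (show 2 ≤ k from hk)
  have h := congrArg (localize (Fin.castLE (show 2 ≤ k from hk))) hM
  simpa only [localize_mul he, localize_opAt _ he S Nat.one_lt_two hk rfl rfl,
    localize_matAt _ he M Nat.two_pos (by omega : 0 < k) rfl] using h

variable [Algebra ℂ A]

lemma mul_toA_mem_matrix {ι : Type*} [Fintype ι] [DecidableEq ι] (I : Ideal A)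
    {X : Matrix ι ι A} (hX : X ∈ I.matrix ι) (S : Matrix ι ι ℂ) :
    X * toA A S ∈ I.matrix ι := by
  intro a b
  rw [Matrix.mul_apply]
  refine sum_mem fun c _ => ?_
  rw [toA, Matrix.map_apply, ← Algebra.commutes]
  exact I.mul_mem_left _ (hX a c)

lemma matAt_one_sub_smul {k i : ℕ} (hi : i < k) (c : ℂ) (X : Matrix (Fin N) (Fin N) A) :
    matAt N k (1 - c • X) i = 1 - c • matAt N k X i := by
  have h1 : matAt N k (c • X) i = c • matAt N k X i := by
    ext a b
    simp only [matAt, hi, dite_true, Matrix.of_apply, Matrix.smul_apply]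
    split_ifs <;> simp
  rw [eq_sub_iff_add_eq, ← h1, ← matAt_add hi, sub_add_cancel, matAt_one]

lemma localize_castLE_ovSeqProd {n k : ℕ} (hnk : n ≤ k)
    (R Rinv : Matrix (Fin N × Fin N) (Fin N × Fin N) A) (X : Matrix (Fin N) (Fin N) A) :
    localize (Fin.castLE hnk) (ovSeqProd (opAt N n R) (opAt N n Rinv) (matAt N n X 0) n) =
      ovSeqProd (opAt N k R) (opAt N k Rinv) (matAt N k X 0) n := by
  change localizeHom _ (Fin.castLE_injective hnk) _ = _
  rw [ovSeqProd, ovSeqProd, map_list_prod, List.map_map]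
  congr 1
  refine List.map_congr_left fun r hr => ?_
  exact localize_castLE_ovSeq hnk R Rinv X r (List.mem_range.1 hr)

lemma localize_castLE_mem_braidAlg {n k : ℕ} (hnk : n ≤ k)
    (R : Matrix (Fin N × Fin N) (Fin N × Fin N) A) {Z : TMat N n A}
    (hZ : Z ∈ braidAlg (opAt N n R) n) :
    localize (Fin.castLE hnk) Z ∈ braidAlg (opAt N k R) n := by
  have he := Fin.castLE_injective hnk
  have h : (braidAlg (opAt N n R) n).map (localizeHom _ he) ≤ braidAlg (opAt N k R) n := by
    rw [braidAlg, AlgHom.map_adjoin]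
    refine Algebra.adjoin_mono ?_
    rintro _ ⟨_, ⟨i, hi, rfl⟩, rfl⟩
    exact ⟨i, hi, localize_opAt _ he _ hi (by omega) rfl rfl⟩
  exact h ⟨Z, hZ, rfl⟩

variable {R Rinv : Matrix (Fin N × Fin N) (Fin N × Fin N) ℂ} {M D : Matrix (Fin N) (Fin N) A}

lemma PermRel.lift (hDM : PermRel N R Rinv M D) {k : ℕ} (hk : 1 < k) :
    matAt N k D 0 * opAt N k (toA A R) 0 * matAt N k M 0 * opAt N k (toA A R) 0 =
      opAt N k (toA A R) 0 * matAt N k M 0 * opAt N k (toA A Rinv) 0 * matAt N k D 0 +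
        opAt N k (toA A R) 0 := by
  have he := Fin.castLE_injective (show 2 ≤ k from hk)
  have h := congrArg (localize (Fin.castLE (show 2 ≤ k from hk))) hDM
  simpa only [localize_mul he, localize_add, localize_opAt _ he _ Nat.one_lt_two hk rfl rfl,
    localize_matAt _ he _ Nat.two_pos (by omega : 0 < k) rfl] using h

end ActionOnMonomials

/-- Every generalized quantum Casimir operator
`Tr_{R(1…p)}(Q·K̂_{[p→1]})` maps the characteristic subalgebra into itself (preserving
the degree in `M`), modulo the left ideal generated by the entries of `D`. -/
theorem stmt10 {A : Type*} [Ring A] [Algebra ℂ A] (N : ℕ) (hN : 1 ≤ N) (q : ℂ)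
    (hq : GenericQ q)
    (R Rinv Ψ : Matrix (Fin N × Fin N) (Fin N × Fin N) ℂ)
    (hRinv : R * Rinv = 1 ∧ Rinv * R = 1)
    (hbraid : IsBraid N R) (hHecke : IsHecke N q R)
    (hΨ : SkewInv N R Ψ)
    (M D : Matrix (Fin N) (Fin N) A)
    (hM : RErel N (toA A R) M)
    (hD : RErel N (toA A Rinv) D)
    (hDM : PermRel N R Rinv M D)
    (n p : ℕ) (hn : 1 ≤ n) (hp : 1 ≤ p)
    (Q : Matrix (Fin p → Fin N) (Fin p → Fin N) A)
    (hQ : Q ∈ Algebra.adjoin ℂ (genSet N p p (toA A R)))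
    (Z : Matrix (Fin n → Fin N) (Fin n → Fin N) A)
    (hZ : Z ∈ Algebra.adjoin ℂ (genSet N n n (toA A R))) :
    ∃ Zt : Matrix (Fin n → Fin N) (Fin n → Fin N) A,
      Zt ∈ Algebra.adjoin ℂ (genSet N n n (toA A R)) ∧
      (qTr N p (toA A (traceMat N Ψ))
          (Q * ((List.range p).reverse.map
            (unCopy N p (toA A R) (toA A Rinv)
              ((1 : Matrix (Fin N) (Fin N) A) - (q - q⁻¹) • (M * D)))).prod) *
        qTr N n (toA A (traceMat N Ψ)) (Z * ovProd N n (toA A R) (toA A Rinv) M n) -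
        qTr N n (toA A (traceMat N Ψ)) (Zt * ovProd N n (toA A R) (toA A Rinv) M n)) ∈
        entryIdeal A D := by
  obtain ⟨k, rfl, Q', hQ', htr⟩ := exists_isPtrOf_shift hq.1 hRinv hbraid hHecke hΨ
    ((1 : Matrix (Fin N) (Fin N) A) - (q - q⁻¹) • (M * D)) p Q hQ n
  have hk : 0 < n + p := by omega
  have hnk : n ≤ n + p := Nat.le_add_right n p
  have hg := isBraidSeq_opAt (A := A) hRinv hbraid (n + p)
  let I : Ideal A := entryIdeal A D
  have hd : matAt N (n + p) D 0 ∈ I.matrix (Fin (n + p) → Fin N) :=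
    matAt_mem_matrix I hk fun a b => Submodule.subset_span ⟨a, b, rfl⟩
  have hK : matAt N (n + p) ((1 : Matrix (Fin N) (Fin N) A) - (q - q⁻¹) • (M * D)) 0 =
      1 - (q - q⁻¹) • (matAt N (n + p) M 0 * matAt N (n + p) D 0) := by
    rw [matAt_one_sub_smul hk, matAt_mul hk]
  have hJ : ∀ S : Matrix (Fin N × Fin N) (Fin N × Fin N) ℂ, ∀ i,
      ∀ z ∈ I.matrix (Fin (n + p) → Fin N),
        z * opAt N (n + p) (toA A S) i ∈ I.matrix (Fin (n + p) → Fin N) := by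
    intro S i z hz
    rw [opAt_toA]
    exact mul_toA_mem_matrix I hz _
  obtain ⟨Y, hY, hmem⟩ := hg.exists_prod_unSeq_mul_sub_mem (I.matrix (Fin (n + p) → Fin N))
    (fun i hi => inv_mem_braidAlg hq.1 hRinv hHecke (Nat.lt_succ_self _) hi)
    (x := matAt N (n + p) ((1 : Matrix (Fin N) (Fin N) A) - (q - q⁻¹) • (M * D)) 0)
    (y := matAt N (n + p) M 0)
    (fun j hj => matAt_commute_opAt _ _ _ hj) (fun j hj => matAt_commute_opAt _ _ _ hj)
    (fun h1 => by
      rw [hK]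
      exact hg.exchange_of_double (opAt_eq_inv_add hq.1 hRinv hHecke h1) (hM.lift h1)
        (hDM.lift h1))
    (hJ R) (hJ Rinv)
    (by
      rw [hK, sub_sub_cancel_left, ← smul_mul_assoc, ← neg_mul]
      exact Ideal.mul_mem_left _ _ hd)
    n p le_rfl (localize (Fin.castLE hnk) Z) (localize_castLE_mem_braidAlg hnk _ hZ)
  obtain ⟨Zt, hZt, htr'⟩ := exists_isPtrOf_mem_braidAlg hq.1 hRinv hbraid hHecke hΨ hn hnk
    (Q' * Y) (mul_mem hQ' hY)
  refine ⟨Zt, hZt, ?_⟩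
  have h1 := (htr.mul_localize (Z * ovProd N n (toA A R) (toA A Rinv) M n) hnk).qTr_eq
  have h2 := (htr'.mul_localize (ovProd N n (toA A R) (toA A Rinv) M n) hnk).qTr_eq
  rw [qTr_diagonal_mul] at h1
  rw [unCopy_eq_unSeq, ← h1, ← h2, ← qTr_sub, localize_mul (Fin.castLE_injective hnk), ovProd_eq_ovSeqProd,
    localize_castLE_ovSeqProd, mul_assoc Q', mul_assoc Q', ← mul_sub]
  exact qTr_mem I _ (Ideal.mul_mem_left _ _ hmem)
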